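/- The restriction of any universal LD^sc Laver function to the class of strong cardinals that are not supercompact still witnesses LD^sc: if ℓ : Ord → V is a universal LD^sc Laver function and ℓ* is its restriction to the non-supercompact strong cardinals, then for every supercompact cardinal κ the function ℓ*↾κ is a LD^sc_κ Laver function. -/

import Mathlib

open FirstOrder

universe u

namespace LaverDiamond

/-- The relation symbols of the language of set theory: a single binary relation `mem`. -/
inductive memRel : ℕ → Type
  | mem : memRel 2

/-- The first-order language of set theory. -/
def SetLang : FirstOrder.Language := ⟨fun _ => Empty, memRel⟩

/-- Any class of ZF-sets is a structure in the language of set theory, with the true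
membership relation. -/
instance classStructure (M : Set ZFSet.{u}) : SetLang.Structure M where
  funMap := fun {_} f _ => f.elim
  RelMap := fun {_} r x => match r with
    | .mem => (x 0 : ZFSet) ∈ (x 1 : ZFSet)

/-- A (fully) elementary embedding from the class `M` to the class `N`, both classes of
ZF-sets equipped with the true membership relation.  It is coded by a global function
`j : ZFSet → ZFSet` mapping `M` into `N`, elementary for all first-order formulas
with parameters from `M`. -/
structure ClassEmb (M N : Set ZFSet.{u}) where
  j : ZFSet.{u} → ZFSet.{u}
  maps : ∀ x, x ∈ M → j x ∈ N
  elem : ∀ {n : ℕ} (φ : SetLang.Formula (Fin n)) (v : Fin n → ZFSet.{u}) (hv : ∀ i, v i ∈ M),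
    φ.Realize (fun i => (⟨v i, hv i⟩ : M)) ↔ φ.Realize (fun i => (⟨j (v i), maps _ (hv i)⟩ : N))

/-- The universe of all ZF-sets, as a class. -/
def V : Set ZFSet.{u} := Set.univ

/-- A transitive class of ZF-sets. -/
def TransClass (M : Set ZFSet.{u}) : Prop := ∀ x ∈ M, ∀ y ∈ x, y ∈ M

/-- `j` has critical point `κ`: `κ` is an ordinal, fixed below `κ`, with `j(κ) > κ`. -/
def CritPt (j : ZFSet.{u} → ZFSet.{u}) (κ : ZFSet.{u}) : Prop :=
  κ.IsOrdinal ∧ κ ∈ j κ ∧ ∀ α : ZFSet, α.IsOrdinal → α ∈ κ → j α = α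

/-- `x` is a member of the rank-initial segment `V_θ`. -/
def MemV (θ x : ZFSet.{u}) : Prop := x.rank < θ.rank

/-- `κ` is a cardinal: an ordinal not equinumerous with any smaller ordinal. -/
def IsCard (κ : ZFSet.{u}) : Prop :=
  κ.IsOrdinal ∧ ∀ β ∈ κ, Cardinal.mk β.toSet < Cardinal.mk κ.toSet

/-- `x ∈ H(θ⁺)`, i.e. `x` has hereditary size at most `θ`. -/
def MemH (θ x : ZFSet.{u}) : Prop :=
  ∃ t : ZFSet, t.IsTransitive ∧ x ∈ t ∧ Cardinal.mk t.toSet ≤ Cardinal.mk θ.toSet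

/-- `f` is a set-function with domain `θ` taking values in the class `M`. -/
def IsFuncInto (θ : ZFSet.{u}) (M : Set ZFSet.{u}) (f : ZFSet.{u}) : Prop :=
  (∀ p ∈ f, ∃ a b : ZFSet, a ∈ θ ∧ b ∈ M ∧ p = ZFSet.pair a b) ∧
  ∀ a ∈ θ, ∃! b : ZFSet, ZFSet.pair a b ∈ f

/-- The class `M` is closed under `θ`-sequences: `M^θ ⊆ M`. -/
def SeqClosed (θ : ZFSet.{u}) (M : Set ZFSet.{u}) : Prop :=
  ∀ f : ZFSet, IsFuncInto θ M f → f ∈ M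

/-- The set `M` is closed under `<κ`-sequences: `M^{<κ} ⊆ M`. -/
def SeqClosedLt (κ M : ZFSet.{u}) : Prop :=
  ∀ α : ZFSet, α ∈ κ → ∀ f : ZFSet, IsFuncInto α M.toSet f → f ∈ M

/-- `ℓ` is a partial function from `κ` to `V_κ` (coded as a set of Kuratowski pairs). -/
def IsPFun (κ ℓ : ZFSet.{u}) : Prop :=
  (∀ p ∈ ℓ, ∃ γ A : ZFSet, γ ∈ κ ∧ MemV κ A ∧ p = ZFSet.pair γ A) ∧
  ∀ γ A B : ZFSet, ZFSet.pair γ A ∈ ℓ → ZFSet.pair γ B ∈ ℓ → A = B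

/-- The set `r` is the restriction to `κ` of the class function `ℓ` (defined on the
ordinals below `κ`), coded as a set of Kuratowski pairs. -/
def RestrictEq (ℓ : ZFSet.{u} → ZFSet.{u}) (κ r : ZFSet.{u}) : Prop :=
  ∀ p : ZFSet, p ∈ r ↔ ∃ γ : ZFSet, γ ∈ κ ∧ p = ZFSet.pair γ (ℓ γ)

/-- The set `r` is the restriction to `κ` of the class function `ℓ` restricted further to
the class `D`. -/
def RestrictEqOn (ℓ : ZFSet.{u} → ZFSet.{u}) (D : Set ZFSet.{u}) (κ r : ZFSet.{u}) : Prop :=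
  ∀ p : ZFSet, p ∈ r ↔ ∃ γ : ZFSet, γ ∈ κ ∧ γ ∈ D ∧ p = ZFSet.pair γ (ℓ γ)

/-- The set `r` is the restriction to `δ` of the set partial function `ℓ`. -/
def RestrictSet (ℓ δ r : ZFSet.{u}) : Prop :=
  ∀ p : ZFSet, p ∈ r ↔ p ∈ ℓ ∧ ∃ γ A : ZFSet, γ ∈ δ ∧ p = ZFSet.pair γ A

/-! ### Supercompactness -/

/-- A `θ`-supercompactness embedding with critical point `κ`: an elementary embedding
`j : V → M` with `M` a transitive class closed under `θ`-sequences and `j(κ) > θ`. -/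
structure SCEmb (κ θ : ZFSet.{u}) where
  M : Set ZFSet.{u}
  trans : TransClass M
  e : ClassEmb V M
  crit : CritPt e.j κ
  closed : SeqClosed θ M
  big : θ ∈ e.j κ

/-- `κ` is `θ`-supercompact. -/
def SCAt (κ θ : ZFSet.{u}) : Prop := Nonempty (SCEmb κ θ)

/-- `κ` is supercompact: `θ`-supercompact for every cardinal `θ`. -/
def Supercompact (κ : ZFSet.{u}) : Prop := ∀ θ : ZFSet, IsCard θ → SCAt κ θ

/-- `ℓ` is a Laver function witnessing the Laver diamond `LD^sc_κ`. -/
def LDscFun (κ ℓ : ZFSet.{u}) : Prop :=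
  IsPFun κ ℓ ∧ ∀ θ A : ZFSet, IsCard θ → MemH θ A →
    ∃ E : SCEmb κ θ, ZFSet.pair κ A ∈ E.e.j ℓ

/-- The Laver diamond principle `LD^sc_κ`. -/
def LDsc (κ : ZFSet.{u}) : Prop := ∃ ℓ : ZFSet, LDscFun κ ℓ

/-- A universal `LD^sc` Laver function. -/
def UnivLDsc (ℓ : ZFSet.{u} → ZFSet.{u}) : Prop :=
  ∀ κ : ZFSet, Supercompact κ → ∃ r : ZFSet, RestrictEq ℓ κ r ∧ LDscFun κ r

/-! ### Strongness -/

/-- A `θ`-strongness embedding with critical point `κ`: an elementary `j : V → M` with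
`M` a transitive class and `V_θ ⊆ M`. -/
structure StrEmb (κ θ : ZFSet.{u}) where
  M : Set ZFSet.{u}
  trans : TransClass M
  e : ClassEmb V M
  crit : CritPt e.j κ
  vsub : ∀ x : ZFSet, MemV θ x → x ∈ M

/-- `κ` is `θ`-strong. -/
def StrongAt (κ θ : ZFSet.{u}) : Prop := Nonempty (StrEmb κ θ)

/-- `κ` is a strong cardinal. -/
def Strong (κ : ZFSet.{u}) : Prop := ∀ θ : ZFSet, θ.IsOrdinal → StrongAt κ θ

/-- `ℓ` witnesses the Laver diamond `LD^strong_κ`. -/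
def LDstrongFun (κ ℓ : ZFSet.{u}) : Prop :=
  IsPFun κ ℓ ∧ ∀ θ A : ZFSet, θ.IsOrdinal → MemV θ A →
    ∃ E : StrEmb κ θ, ZFSet.pair κ A ∈ E.e.j ℓ

/-- The Laver diamond principle `LD^strong_κ`. -/
def LDstrong (κ : ZFSet.{u}) : Prop := ∃ ℓ : ZFSet, LDstrongFun κ ℓ

/-- A universal `LD^strong` Laver function. -/
def UnivLDstrong (ℓ : ZFSet.{u} → ZFSet.{u}) : Prop :=
  ∀ κ : ZFSet, Strong κ → ∃ r : ZFSet, RestrictEq ℓ κ r ∧ LDstrongFun κ r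

/-! ### Measurability -/

/-- An embedding witnessing measurability of `κ`: an elementary `j : V → M`
with `M` a transitive class and critical point `κ`. -/
structure MeasEmb (κ : ZFSet.{u}) where
  M : Set ZFSet.{u}
  trans : TransClass M
  e : ClassEmb V M
  crit : CritPt e.j κ

/-- `κ` is a measurable cardinal. -/
def MeasurableCard (κ : ZFSet.{u}) : Prop := Nonempty (MeasEmb κ)

/-- `ℓ` witnesses the Laver diamond `LD^meas_κ`. -/
def LDmeasFun (κ ℓ : ZFSet.{u}) : Prop :=
  IsPFun κ ℓ ∧ ∀ A : ZFSet, MemH κ A → ∃ E : MeasEmb κ, ZFSet.pair κ A ∈ E.e.j ℓ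

/-- The Laver diamond principle `LD^meas_κ`. -/
def LDmeas (κ : ZFSet.{u}) : Prop := ∃ ℓ : ZFSet, LDmeasFun κ ℓ

/-- A universal `LD^meas` Laver function. -/
def UnivLDmeas (ℓ : ZFSet.{u} → ZFSet.{u}) : Prop :=
  ∀ κ : ZFSet, MeasurableCard κ → ∃ r : ZFSet, RestrictEq ℓ κ r ∧ LDmeasFun κ r

/-! ### Weak compactness -/

/-- `κ` is weakly compact: every transitive set `M` of size `κ` with `κ ∈ M` admits an
elementary embedding `j : M → N` into a transitive set `N` with critical point `κ`. -/
def WeaklyCompact (κ : ZFSet.{u}) : Prop :=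
  ∀ M : ZFSet, M.IsTransitive → Cardinal.mk M.toSet = Cardinal.mk κ.toSet → κ ∈ M →
    ∃ N : ZFSet, N.IsTransitive ∧ ∃ e : ClassEmb M.toSet N.toSet, CritPt e.j κ

/-- `ℓ` witnesses the Laver diamond `LD^wc_κ`. -/
def LDwcFun (κ ℓ : ZFSet.{u}) : Prop :=
  IsPFun κ ℓ ∧ ∀ A M : ZFSet, MemH κ A →
    M.IsTransitive → Cardinal.mk M.toSet = Cardinal.mk κ.toSet → κ ∈ M → A ∈ M → ℓ ∈ M →
    ∃ N : ZFSet, N.IsTransitive ∧ ∃ e : ClassEmb M.toSet N.toSet,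
      CritPt e.j κ ∧ ZFSet.pair κ A ∈ e.j ℓ

/-- The Laver diamond principle `LD^wc_κ`. -/
def LDwc (κ : ZFSet.{u}) : Prop := ∃ ℓ : ZFSet, LDwcFun κ ℓ

/-- A universal `LD^wc` Laver function. -/
def UnivLDwc (ℓ : ZFSet.{u} → ZFSet.{u}) : Prop :=
  ∀ κ : ZFSet, WeaklyCompact κ → ∃ r : ZFSet, RestrictEq ℓ κ r ∧ LDwcFun κ r

/-! ### Nice structures and unfoldability -/

/-- `M` is a nice structure for `κ`: a transitive set of size `κ`, closed under
`<κ`-sequences, with `κ ∈ M`. -/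
def Nice (κ M : ZFSet.{u}) : Prop :=
  M.IsTransitive ∧ Cardinal.mk M.toSet = Cardinal.mk κ.toSet ∧ SeqClosedLt κ M ∧ κ ∈ M

/-- `κ` is unfoldable: for every ordinal `θ`, every nice structure admits a
`θ`-unfoldability embedding. -/
def Unfoldable (κ : ZFSet.{u}) : Prop :=
  ∀ θ M : ZFSet, θ.IsOrdinal → Nice κ M →
    ∃ N : ZFSet, N.IsTransitive ∧ ∃ e : ClassEmb M.toSet N.toSet, CritPt e.j κ ∧ θ ∈ e.j κ

/-- `ℓ` witnesses the Laver diamond `LD^unf_κ`. -/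
def LDunfFun (κ ℓ : ZFSet.{u}) : Prop :=
  IsPFun κ ℓ ∧ ∀ θ A M : ZFSet, θ.IsOrdinal → MemH κ A →
    M.IsTransitive → Cardinal.mk M.toSet = Cardinal.mk κ.toSet → SeqClosedLt κ M →
    κ ∈ M → ℓ ∈ M → A ∈ M →
    ∃ N : ZFSet, N.IsTransitive ∧ ∃ e : ClassEmb M.toSet N.toSet,
      CritPt e.j κ ∧ θ ∈ e.j κ ∧ ZFSet.pair κ A ∈ e.j ℓ

/-- The Laver diamond principle `LD^unf_κ`. -/
def LDunf (κ : ZFSet.{u}) : Prop := ∃ ℓ : ZFSet, LDunfFun κ ℓ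

/-- `ℓ` witnesses the Laver diamond `LD^sunf_κ` for strong unfoldability. -/
def LDsunfFun (κ ℓ : ZFSet.{u}) : Prop :=
  IsPFun κ ℓ ∧ ∀ θ A M : ZFSet, IsCard θ → MemH θ A →
    M.IsTransitive → Cardinal.mk M.toSet = Cardinal.mk κ.toSet → SeqClosedLt κ M →
    κ ∈ M → ℓ ∈ M →
    ∃ N : ZFSet, N.IsTransitive ∧ (∀ x : ZFSet, MemV θ x → x ∈ N) ∧
      ∃ e : ClassEmb M.toSet N.toSet, CritPt e.j κ ∧ θ ∈ e.j κ ∧ ZFSet.pair κ A ∈ e.j ℓ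

/-! ### Ramsey cardinals -/

/-- `F` is a weakly amenable `M`-normal measure on `κ`. -/
def MNormalMeasure (κ M F : ZFSet.{u}) : Prop :=
  (∀ X ∈ F, X ⊆ κ ∧ X ∈ M) ∧ κ ∈ F ∧ (∅ : ZFSet) ∉ F ∧
  (∀ X Y : ZFSet, X ∈ F → Y ∈ F → X ∩ Y ∈ F) ∧
  (∀ X Y : ZFSet, X ∈ F → Y ∈ M → X ⊆ Y → Y ⊆ κ → Y ∈ F) ∧
  (∀ X : ZFSet, X ∈ M → X ⊆ κ → (X ∈ F ∨ κ \ X ∈ F)) ∧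
  (∀ ξ ∈ κ, ({ξ} : ZFSet) ∉ F) ∧
  (∀ γ f : ZFSet, γ ∈ κ → f ∈ M → IsFuncInto γ F.toSet f →
    ZFSet.sep (fun ξ => ∀ a X : ZFSet, ZFSet.pair a X ∈ f → ξ ∈ X) κ ∈ F) ∧
  (∀ f : ZFSet, f ∈ M → IsFuncInto κ F.toSet f →
    ZFSet.sep (fun ξ => ∀ a X : ZFSet, ZFSet.pair a X ∈ f → a ∈ ξ → ξ ∈ X) κ ∈ F) ∧
  (∀ D : ZFSet, D ∈ M → MemH κ D → F ∩ D ∈ M)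

/-- `j` is (isomorphic to) the ultrapower map of `M` by the `M`-measure `F` on `κ`, with
transitive (wellfounded) target `N`: `j` is elementary, has critical point `κ`, derives the
measure `F` at `κ`, and every element of `N` has the form `j(f)(κ)` for some function
`f ∈ M` with domain `κ`. -/
def IsUltrapowerMap (κ M F N : ZFSet.{u}) (j : ZFSet.{u} → ZFSet.{u}) : Prop :=
  N.IsTransitive ∧ (∃ e : ClassEmb M.toSet N.toSet, e.j = j) ∧ CritPt j κ ∧
  (∀ X : ZFSet, X ∈ M → X ⊆ κ → (X ∈ F ↔ κ ∈ j X)) ∧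
  (∀ y ∈ N, ∃ f : ZFSet, f ∈ M ∧ (∀ a ∈ κ, ∃! b : ZFSet, ZFSet.pair a b ∈ f) ∧
    ZFSet.pair κ y ∈ j f)

/-- A wellfounded iteration of `⟨M, F⟩` of length `δ`: a commuting system of elementary
embeddings between transitive models, starting at `⟨M, F⟩`, taking ultrapowers by the
image measures at successor steps and direct limits at limit stages. -/
structure Iteration (κ M F δ : ZFSet.{u}) where
  Mod : ZFSet.{u} → ZFSet.{u}
  Meas : ZFSet.{u} → ZFSet.{u}
  cp : ZFSet.{u} → ZFSet.{u}
  emb : ZFSet.{u} → ZFSet.{u} → ZFSet.{u} → ZFSet.{u}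
  mod_zero : Mod ∅ = M
  meas_zero : Meas ∅ = F
  cp_zero : cp ∅ = κ
  trans' : ∀ i : ZFSet, i ∈ δ → (Mod i).IsTransitive
  elem' : ∀ i k : ZFSet, i ∈ δ → k ∈ δ → i ∈ k →
    ∃ e : ClassEmb (Mod i).toSet (Mod k).toSet, e.j = emb i k
  comm : ∀ i k l : ZFSet, i ∈ δ → k ∈ δ → l ∈ δ → i ∈ k → k ∈ l →
    ∀ x ∈ Mod i, emb k l (emb i k x) = emb i l x
  cp_emb : ∀ i : ZFSet, i ∈ δ → i ≠ ∅ → cp i = emb ∅ i κ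
  succ' : ∀ i : ZFSet, i ∈ δ → insert i i ∈ δ →
    IsUltrapowerMap (cp i) (Mod i) (Meas i) (Mod (insert i i)) (emb i (insert i i)) ∧
    (∀ Y : ZFSet, Y ∈ Meas (insert i i) ↔
      ∃ D : ZFSet, D ∈ Mod i ∧ Y ∈ emb i (insert i i) (Meas i ∩ D))
  limit' : ∀ l : ZFSet, l ∈ δ → l ≠ ∅ → (∀ i ∈ l, insert i i ∈ l) →
    (∀ y ∈ Mod l, ∃ i : ZFSet, i ∈ l ∧ ∃ x, x ∈ Mod i ∧ emb i l x = y) ∧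
    (∀ Y : ZFSet, Y ∈ Meas l ↔
      ∃ i : ZFSet, i ∈ l ∧ ∃ D, D ∈ Mod i ∧ Y ∈ emb i l (Meas i ∩ D))

/-- `⟨M, F⟩` is iterable: all its iterations (of any ordinal length) are wellfounded,
i.e. realized by transitive models. -/
def Iterable (κ M F : ZFSet.{u}) : Prop :=
  ∀ δ : ZFSet, δ.IsOrdinal → Nonempty (Iteration κ M F δ)

/-! ### Constructibility -/

/-- `X` is a subset of `M` definable over `⟨M, ∈⟩` with parameters. -/
def DefinableSubset (M X : ZFSet.{u}) : Prop :=
  X ⊆ M ∧ ∃ (n : ℕ) (φ : SetLang.Formula (Fin (n + 1))) (v : Fin n → ZFSet.{u})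
    (hv : ∀ i, v i ∈ M.toSet),
    ∀ a : ZFSet, a ∈ X ↔ ∃ ha : a ∈ M.toSet,
      φ.Realize (Fin.cons (⟨a, ha⟩ : M.toSet) (fun i => (⟨v i, hv i⟩ : M.toSet)))

/-- The set of all subsets of `M` definable over `⟨M, ∈⟩` with parameters. -/
noncomputable def DefSet (M : ZFSet.{u}) : ZFSet.{u} :=
  ZFSet.sep (fun X => DefinableSubset M X) (ZFSet.powerset M)

/-- `h` codes the constructible hierarchy up to `δ`: a function with domain `δ` such that
`h(β) = ⋃_{γ<β} Def(h(γ))` for every `β < δ`. -/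
def IsLHierarchy (δ h : ZFSet.{u}) : Prop :=
  δ.IsOrdinal ∧
  (∀ p ∈ h, ∃ β y : ZFSet, β ∈ δ ∧ p = ZFSet.pair β y) ∧
  (∀ β ∈ δ, ∃! y : ZFSet, ZFSet.pair β y ∈ h) ∧
  ∀ β y : ZFSet, ZFSet.pair β y ∈ h →
    ∀ z : ZFSet, z ∈ y ↔ ∃ γ x : ZFSet, γ ∈ β ∧ ZFSet.pair γ x ∈ h ∧ z ∈ DefSet x

/-- `x` is constructible: it appears at some level of some constructible hierarchy. -/
def Constructible (x : ZFSet.{u}) : Prop :=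
  ∃ δ h β y : ZFSet, IsLHierarchy δ h ∧ ZFSet.pair β y ∈ h ∧ x ∈ y

/-- The axiom of constructibility `V = L`. -/
def VeqL : Prop := ∀ x : ZFSet.{u}, Constructible x

/-! ### Normal measures -/

/-- `U` is a normal measure on `κ`: a `κ`-complete nonprincipal ultrafilter on `κ`
closed under diagonal intersections. -/
def IsNormalMeasure (κ U : ZFSet.{u}) : Prop :=
  (∀ X ∈ U, X ⊆ κ) ∧ κ ∈ U ∧ (∅ : ZFSet) ∉ U ∧
  (∀ X Y : ZFSet, X ∈ U → Y ∈ U → X ∩ Y ∈ U) ∧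
  (∀ X Y : ZFSet, X ∈ U → X ⊆ Y → Y ⊆ κ → Y ∈ U) ∧
  (∀ X : ZFSet, X ⊆ κ → (X ∈ U ∨ κ \ X ∈ U)) ∧
  (∀ ξ ∈ κ, ({ξ} : ZFSet) ∉ U) ∧
  (∀ γ f : ZFSet, γ ∈ κ → IsFuncInto γ U.toSet f →
    ZFSet.sep (fun ξ => ∀ a X : ZFSet, ZFSet.pair a X ∈ f → ξ ∈ X) κ ∈ U) ∧
  (∀ f : ZFSet, IsFuncInto κ U.toSet f →
    ZFSet.sep (fun ξ => ∀ a X : ZFSet, ZFSet.pair a X ∈ f → a ∈ ξ → ξ ∈ X) κ ∈ U)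

end LaverDiamond

open LaverDiamond

namespace LaverDiamond

/-- The predicate `P`, with parameters indexed by `Γ`, is first-order over transitive classes. -/
def FO {Γ : Type} (P : Set ZFSet.{u} → (Γ → ZFSet.{u}) → Prop) : Prop :=
  ∃ φ : SetLang.Formula Γ, ∀ M : Set ZFSet.{u}, TransClass M → ∀ v : Γ → M,
    φ.Realize v ↔ P M (fun i => (v i : ZFSet))

/-- The membership symbol, as a symbol of `SetLang`. -/
def memSym : SetLang.Relations 2 := memRel.mem

namespace FO

variable {Γ : Type} {P Q : Set ZFSet.{u} → (Γ → ZFSet.{u}) → Prop}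

theorem congr (h : FO P)
    (e : ∀ M : Set ZFSet.{u}, TransClass M → ∀ v : Γ → M,
      (Q M (fun i => (v i : ZFSet)) ↔ P M (fun i => (v i : ZFSet)))) : FO Q := by
  obtain ⟨φ, hφ⟩ := h
  exact ⟨φ, fun M hM v => (hφ M hM v).trans (e M hM v).symm⟩

theorem eq (a b : Γ) : FO.{u} (fun _ v => v a = v b) :=
  ⟨(Language.Term.var a).equal (Language.Term.var b), fun M _ v => by
    simp [Language.Formula.realize_equal, Subtype.ext_iff]⟩

theorem mem (a b : Γ) : FO.{u} (fun _ v => v a ∈ v b) :=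
  ⟨memSym.formula₂ (Language.Term.var a) (Language.Term.var b), fun _ _ _ =>
    Language.Formula.realize_rel₂.trans Iff.rfl⟩

theorem not (h : FO P) : FO (fun M v => ¬ P M v) := by
  obtain ⟨φ, hφ⟩ := h
  exact ⟨φ.not, fun M hM v => by rw [Language.Formula.realize_not, hφ M hM v]⟩

theorem imp (h : FO P) (h' : FO Q) : FO (fun M v => P M v → Q M v) := by
  obtain ⟨φ, hφ⟩ := h
  obtain ⟨ψ, hψ⟩ := h'
  exact ⟨φ.imp ψ, fun M hM v => by rw [Language.Formula.realize_imp, hφ M hM v, hψ M hM v]⟩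

theorem and (h : FO P) (h' : FO Q) : FO (fun M v => P M v ∧ Q M v) := by
  refine (h.imp h'.not).not.congr fun M hM v => by tauto

theorem or (h : FO P) (h' : FO Q) : FO (fun M v => P M v ∨ Q M v) := by
  refine (h.not.imp h').congr fun M hM v => by tauto

theorem iff (h : FO P) (h' : FO Q) : FO (fun M v => P M v ↔ Q M v) := by
  refine ((h.imp h').and (h'.imp h)).congr fun M hM v => by tauto

theorem all {R : Set ZFSet.{u} → (Γ → ZFSet.{u}) → ZFSet.{u} → Prop}
    (h : FO (fun M (v : Option Γ → ZFSet.{u}) => R M (fun i => v (some i)) (v none))) :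
    FO (fun M v => ∀ x, x ∈ M → R M v x) := by
  obtain ⟨φ, hφ⟩ := h
  let f : Option Γ → Γ ⊕ Unit := fun o => o.elim (Sum.inr ()) Sum.inl
  refine ⟨Language.Formula.iAlls Unit (φ.relabel f), fun M hM v => ?_⟩
  rw [Language.Formula.realize_iAlls]
  have key : ∀ i : Unit → M, (φ.relabel f).Realize (fun a => Sum.elim v i a) ↔
      R M (fun i => (v i : ZFSet)) (i ()) := by
    intro i
    rw [Language.Formula.realize_relabel, hφ M hM]
    rfl
  constructor
  · intro H x hx
    exact (key fun _ => ⟨x, hx⟩).1 (H _)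
  · intro H i
    exact (key i).2 (H _ (i ()).2)

theorem ex {R : Set ZFSet.{u} → (Γ → ZFSet.{u}) → ZFSet.{u} → Prop}
    (h : FO (fun M (v : Option Γ → ZFSet.{u}) => R M (fun i => v (some i)) (v none))) :
    FO (fun M v => ∃ x, x ∈ M ∧ R M v x) := by
  refine (all (R := fun M v x => ¬ R M v x) h.not).not.congr fun M hM v => ?_
  push Not
  rfl

theorem ball (a : Γ) {R : Set ZFSet.{u} → (Γ → ZFSet.{u}) → ZFSet.{u} → Prop}
    (h : FO (fun M (v : Option Γ → ZFSet.{u}) => R M (fun i => v (some i)) (v none))) :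
    FO (fun M v => ∀ x, x ∈ v a → R M v x) := by
  refine (all (R := fun M v x => x ∈ v a → R M v x) ((mem none (some a)).imp h)).congr
    fun M hM v => ?_
  exact ⟨fun H x _ hx => H x hx, fun H x hx => H x (hM _ (v a).2 _ hx) hx⟩

theorem bex (a : Γ) {R : Set ZFSet.{u} → (Γ → ZFSet.{u}) → ZFSet.{u} → Prop}
    (h : FO (fun M (v : Option Γ → ZFSet.{u}) => R M (fun i => v (some i)) (v none))) :
    FO (fun M v => ∃ x, x ∈ v a ∧ R M v x) := by
  refine (ball a (R := fun M v x => ¬ R M v x) h.not).not.congr fun M hM v => ?_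
  push Not
  rfl

theorem subset (a b : Γ) : FO.{u} (fun _ v => v a ⊆ v b) := by
  refine (ball a (R := fun M v x => x ∈ v b) (mem none (some b))).congr fun M hM v => Iff.rfl

theorem trans (a : Γ) : FO.{u} (fun _ v => (v a).IsTransitive) := by
  refine (ball a (R := fun M v x => x ⊆ v a) (subset none (some a))).congr fun M hM v => ?_
  exact Iff.rfl

theorem eq_pair_un (p a b : Γ) : FO.{u} (fun _ v => v p = {v a, v b}) := by
  have : FO.{u} (fun _ (v : Γ → ZFSet.{u}) => v a ∈ v p ∧ v b ∈ v p ∧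
      ∀ x, x ∈ v p → x = v a ∨ x = v b) :=
    (mem _ _).and ((mem _ _).and (ball _ ((eq _ _).or (eq _ _))))
  refine this.congr fun M hM v => ?_
  constructor
  · intro H
    simp only [H]
    simp
  · rintro ⟨h1, h2, h3⟩
    ext z
    rw [ZFSet.mem_pair]
    exact ⟨h3 z, by rintro (rfl | rfl) <;> assumption⟩

theorem eq_pair (p a b : Γ) : FO.{u} (fun _ v => v p = ZFSet.pair (v a) (v b)) := by
  have : FO.{u} (fun _ (v : Γ → ZFSet.{u}) => ∃ s, s ∈ v p ∧ ∃ t, t ∈ v p ∧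
      v p = {s, t} ∧ s = {v a, v a} ∧ t = {v a, v b}) :=
    bex _ (bex _ ((eq_pair_un _ _ _).and ((eq_pair_un _ _ _).and (eq_pair_un _ _ _))))
  refine this.congr fun M hM v => ?_
  constructor
  · intro H
    refine ⟨{(v a : ZFSet)}, ?_, {(v a : ZFSet), (v b : ZFSet)}, ?_, H, ?_, rfl⟩
    · simp only [H]; simp [ZFSet.pair]
    · simp only [H]; simp [ZFSet.pair]
    · ext z; simp
  · rintro ⟨s, _, t, _, h1, rfl, rfl⟩
    simp only [h1, ZFSet.pair]
    congr 1
    ext z; simp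

theorem pair_mem (a b z : Γ) : FO.{u} (fun _ v => ZFSet.pair (v a) (v b) ∈ v z) := by
  have : FO.{u} (fun _ (v : Γ → ZFSet.{u}) => ∃ s, s ∈ v z ∧ s = ZFSet.pair (v a) (v b)) :=
    bex _ (eq_pair _ _ _)
  refine this.congr fun M hM v => ?_
  constructor
  · intro H; exact ⟨_, H, rfl⟩
  · rintro ⟨s, h, rfl⟩; exact h

theorem ord (a : Γ) : FO.{u} (fun _ v => (v a).IsOrdinal) := by
  have : FO.{u} (fun _ (v : Γ → ZFSet.{u}) => (v a).IsTransitive ∧ ∀ x, x ∈ v a →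
      x.IsTransitive) :=
    (trans _).and (ball _ (trans _))
  refine this.congr fun M hM v => ?_
  exact ZFSet.isOrdinal_iff_forall_mem_isTransitive

end FO

theorem transClass_V : TransClass V.{u} := fun _ _ _ _ => trivial

theorem FO.transfer {n : ℕ} {P : Set ZFSet.{u} → (Fin n → ZFSet.{u}) → Prop} (h : FO P)
    {M : Set ZFSet.{u}} (hM : TransClass M) (e : ClassEmb V M) (v : Fin n → ZFSet.{u}) :
    P V v ↔ P M (fun i => e.j (v i)) := by
  obtain ⟨φ, hφ⟩ := h
  have := e.elem φ v (fun _ => trivial)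
  rw [hφ _ transClass_V, hφ _ hM] at this
  exact this

end LaverDiamond

namespace LaverDiamond

open ZFSet Ordinal

/-! ### Sets, graphs, cardinals -/

theorem mk_toSet (x : ZFSet.{u}) : Cardinal.mk x.toSet = Cardinal.lift.{u + 1, u} (card x) :=
  cardinalMk_coe_sort

theorem mk_le_iff {x y : ZFSet.{u}} :
    Cardinal.mk x.toSet ≤ Cardinal.mk y.toSet ↔ card x ≤ card y := by
  rw [mk_toSet, mk_toSet, Cardinal.lift_le]

theorem exists_set {P : ZFSet.{u} → Prop} (o : Ordinal.{u}) (h : ∀ x, P x → rank x < o) :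
    ∃ s : ZFSet.{u}, ∀ x, x ∈ s ↔ P x :=
  ⟨ZFSet.sep P (V_ o), fun x => by
    rw [ZFSet.mem_sep, mem_vonNeumann]; exact ⟨fun h => h.2, fun hx => ⟨h x hx, hx⟩⟩⟩

/-- The graph of `F` on the set `x`. -/
noncomputable def gr (x : ZFSet.{u}) (F : ZFSet.{u} → ZFSet.{u}) : ZFSet.{u} :=
  ZFSet.range (fun a : x => pair a (F a))

theorem mem_gr {x p : ZFSet.{u}} {F : ZFSet.{u} → ZFSet.{u}} :
    p ∈ gr x F ↔ ∃ a ∈ x, p = pair a (F a) := by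
  simp only [gr, ZFSet.mem_range]
  constructor
  · rintro ⟨a, rfl⟩; exact ⟨a, a.2, rfl⟩
  · rintro ⟨a, ha, rfl⟩; exact ⟨⟨a, ha⟩, rfl⟩

theorem pair_mem_gr {x a b : ZFSet.{u}} {F : ZFSet.{u} → ZFSet.{u}} :
    pair a b ∈ gr x F ↔ a ∈ x ∧ b = F a := by
  rw [mem_gr]
  constructor
  · rintro ⟨a', h, e⟩
    obtain ⟨rfl, rfl⟩ := pair_inj.1 e
    exact ⟨h, rfl⟩
  · rintro ⟨h, rfl⟩; exact ⟨a, h, rfl⟩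

theorem rank_opair (a b : ZFSet.{u}) :
    rank (pair a b) = Order.succ (Order.succ (max (rank a) (rank b))) := by
  simp only [pair, rank_pair, rank_singleton]
  rw [max_eq_right]
  · congr 1
    exact (Order.succ_mono.map_max).symm
  · exact Order.succ_le_succ (le_max_left _ _)

theorem rank_opair_lt {o : Ordinal.{u}} (ho : Order.IsSuccLimit o) {a b : ZFSet.{u}}
    (ha : rank a < o) (hb : rank b < o) : rank (pair a b) < o := by
  rw [rank_opair]
  exact ho.succ_lt (ho.succ_lt (max_lt ha hb))

theorem rank_lt_opair (a b : ZFSet.{u}) : rank a < rank (pair a b) ∧ rank b < rank (pair a b) := by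
  rw [rank_opair]
  have h := Order.lt_succ (Order.succ (max (rank a) (rank b)))
  exact ⟨(le_max_left _ _).trans_lt ((Order.lt_succ _).trans h),
    (le_max_right _ _).trans_lt ((Order.lt_succ _).trans h)⟩

theorem card_le_of_surj {x y : ZFSet.{u}} (F : ZFSet.{u} → ZFSet.{u})
    (h : ∀ b ∈ y, ∃ a ∈ x, F a = b) : card y ≤ card x := by
  rw [← mk_le_iff]
  choose g hg hg' using h
  refine ⟨⟨fun b => ⟨g b.1 b.2, hg _ _⟩, fun b b' e => ?_⟩⟩
  have := congrArg Subtype.val e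
  dsimp at this
  exact Subtype.ext (by rw [← hg' b.1 b.2, ← hg' b'.1 b'.2, this])

theorem exists_surj_of_card_le {x y : ZFSet.{u}} (hy : y.Nonempty) (h : card y ≤ card x) :
    ∃ F : ZFSet.{u} → ZFSet.{u}, (∀ a ∈ x, F a ∈ y) ∧ ∀ b ∈ y, ∃ a ∈ x, F a = b := by
  obtain ⟨⟨f, hf⟩⟩ := mk_le_iff.2 h
  obtain ⟨b₀, hb₀⟩ := hy
  classical
  let F : ZFSet.{u} → ZFSet.{u} := fun a =>
    if h : ∃ b : y.toSet, (f b : ZFSet) = a then (h.choose : ZFSet) else b₀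
  refine ⟨F, fun a _ => ?_, fun b hb => ⟨f ⟨b, hb⟩, (f ⟨b, hb⟩).2, ?_⟩⟩
  · by_cases h : ∃ b : y.toSet, (f b : ZFSet) = a
    · simp only [F, dif_pos h]; exact h.choose.2
    · simp only [F, dif_neg h]; exact hb₀
  · have h : ∃ b' : y.toSet, (f b' : ZFSet) = f ⟨b, hb⟩ := ⟨⟨b, hb⟩, rfl⟩
    simp only [F, dif_pos h]
    have := hf (Subtype.ext h.choose_spec)
    rw [this]

theorem isCard_ord (c : Cardinal.{u}) : IsCard c.ord.toZFSet := by
  refine ⟨isOrdinal_toZFSet _, fun β hβ => ?_⟩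
  obtain ⟨a, ha, rfl⟩ := mem_toZFSet_iff.1 hβ
  rw [mk_toSet, mk_toSet, Cardinal.lift_lt, card_toZFSet, card_toZFSet, Cardinal.card_ord]
  exact Cardinal.lt_ord.1 ha

theorem exists_isCard (x : ZFSet.{u}) :
    ∃ θ : ZFSet.{u}, IsCard θ ∧ card x ≤ card θ ∧ rank x < rank θ := by
  refine ⟨_, isCard_ord (max (card x) (Order.succ (rank x).card)), ?_, ?_⟩
  · rw [card_toZFSet, Cardinal.card_ord]; exact le_max_left _ _
  · rw [rank_toZFSet, Cardinal.lt_ord]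
    exact (Order.lt_succ _).trans_le (le_max_right _ _)

theorem mem_of_rank_lt {α β : ZFSet.{u}} (hα : α.IsOrdinal) (hβ : β.IsOrdinal)
    (h : rank α < rank β) : α ∈ β := (hα.rank_lt_iff_mem hβ).1 h

/-! ### Ranks inside transitive classes -/

/-- `M` sees a certificate that the rank of `y` is below `α`. -/
def RankLt (M : Set ZFSet.{u}) (y α : ZFSet.{u}) : Prop :=
  ∃ f, f ∈ M ∧ ((∃ β, β ∈ α ∧ pair y β ∈ f) ∧
    ∀ a, a ∈ M → ∀ β, β ∈ M → pair a β ∈ f → ∀ z, z ∈ a → ∃ γ, γ ∈ β ∧ pair z γ ∈ f)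

/-- `M` sees a certificate that the rank of `y` is at least `α`. -/
def RankGe (M : Set ZFSet.{u}) (y α : ZFSet.{u}) : Prop :=
  ∃ f, f ∈ M ∧ (pair y α ∈ f ∧
    ∀ a, a ∈ M → ∀ β, β ∈ M → pair a β ∈ f → ∀ γ, γ ∈ β → ∃ z, z ∈ a ∧ pair z γ ∈ f)

theorem FO.rankLt {Γ : Type} (a b : Γ) : FO.{u} (fun M v => RankLt M (v a) (v b)) :=
  ex ((bex _ (pair_mem _ _ _)).and
    (all (all ((pair_mem _ _ _).imp (ball _ (bex _ (pair_mem _ _ _)))))))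

theorem FO.rankGe {Γ : Type} (a b : Γ) : FO.{u} (fun M v => RankGe M (v a) (v b)) :=
  ex ((pair_mem _ _ _).and
    (all (all ((pair_mem _ _ _).imp (ball _ (bex _ (pair_mem _ _ _)))))))

theorem TransClass.pair_left {M : Set ZFSet.{u}} (hM : TransClass M) {a b : ZFSet.{u}}
    (h : pair a b ∈ M) : a ∈ M ∧ b ∈ M := by
  have h1 : ({a, b} : ZFSet) ∈ M := hM _ h _ (by simp [pair])
  exact ⟨hM _ h1 _ (by simp), hM _ h1 _ (by simp)⟩

theorem TransClass.of_pair_mem {M : Set ZFSet.{u}} (hM : TransClass M) {a b z : ZFSet.{u}}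
    (h : pair a b ∈ z) (hz : z ∈ M) : a ∈ M ∧ b ∈ M := hM.pair_left (hM _ hz _ h)

theorem RankLt.rank_lt {M : Set ZFSet.{u}} (hM : TransClass M) {y α : ZFSet.{u}}
    (h : RankLt M y α) : rank y < rank α := by
  obtain ⟨f, hf, ⟨β, hβ, hp⟩, H⟩ := h
  have key : ∀ a β, pair a β ∈ f → rank a ≤ rank β := by
    intro a
    induction a using ZFSet.inductionOn with
    | _ a ih =>
      intro β hp
      rw [rank_le_iff]
      intro z hz
      have := hM.of_pair_mem hp hf
      obtain ⟨γ, hγ, hp'⟩ := H a this.1 β this.2 hp z hz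
      exact (ih z hz γ hp').trans_lt (rank_lt_of_mem hγ)
  exact (key _ _ hp).trans_lt (rank_lt_of_mem hβ)

theorem RankGe.rank_le {M : Set ZFSet.{u}} (hM : TransClass M) {y α : ZFSet.{u}}
    (h : RankGe M y α) : rank α ≤ rank y := by
  obtain ⟨f, hf, hp, H⟩ := h
  have key : ∀ β a, pair a β ∈ f → rank β ≤ rank a := by
    intro β
    induction β using ZFSet.inductionOn with
    | _ β ih =>
      intro a hp
      rw [rank_le_iff]
      intro γ hγ
      have := hM.of_pair_mem hp hf
      obtain ⟨z, hz, hp'⟩ := H a this.1 β this.2 hp γ hγ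
      exact (ih γ hγ z hp').trans_lt (rank_lt_of_mem hz)
  exact key _ _ hp

theorem rankLt_or_rankGe {y α : ZFSet.{u}} (hα : α.IsOrdinal) :
    RankLt V y α ∨ RankGe V y α := by
  rcases lt_or_ge (rank y) (rank α) with h | h
  · left
    refine ⟨gr (V_ (Order.succ (rank y))) (fun a => (rank a).toZFSet), trivial,
      ⟨(rank y).toZFSet, ?_, ?_⟩, ?_⟩
    · rw [← hα.toZFSet_rank_eq, toZFSet_mem_toZFSet_iff]; exact h
    · exact pair_mem_gr.2 ⟨mem_vonNeumann_succ _, rfl⟩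
    · intro a _ β _ hp z hz
      obtain ⟨ha, rfl⟩ := pair_mem_gr.1 hp
      refine ⟨_, toZFSet_mem_toZFSet_iff.2 (rank_lt_of_mem hz), pair_mem_gr.2 ⟨?_, rfl⟩⟩
      exact (isTransitive_vonNeumann _).subset_of_mem ha hz
  · right
    obtain ⟨f, hf⟩ := exists_set (P := fun p => ∃ a β : ZFSet.{u}, p = pair a β ∧ β.IsOrdinal ∧
      rank β ≤ rank a ∧ rank a ≤ rank y) (Order.succ (Order.succ (Order.succ (rank y)))) (by
        rintro p ⟨a, β, rfl, _, h1, h2⟩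
        rw [rank_opair, Order.lt_succ_iff, Order.succ_le_succ_iff, Order.succ_le_succ_iff]
        exact max_le h2 (h1.trans h2))
    have hf' : ∀ a β, pair a β ∈ f ↔ β.IsOrdinal ∧ rank β ≤ rank a ∧ rank a ≤ rank y := by
      intro a β
      rw [hf]
      constructor
      · rintro ⟨a', β', e, h'⟩
        obtain ⟨rfl, rfl⟩ := pair_inj.1 e
        exact h'
      · intro h'; exact ⟨a, β, rfl, h'⟩
    refine ⟨f, trivial, (hf' _ _).2 ⟨hα, h, le_rfl⟩, ?_⟩
    intro a _ β _ hp γ hγ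
    obtain ⟨h1, h2, h3⟩ := (hf' _ _).1 hp
    obtain ⟨z, hz, hz'⟩ := lt_rank_iff.1 ((rank_lt_of_mem hγ).trans_le h2)
    exact ⟨z, hz, (hf' _ _).2 ⟨h1.mem hγ, hz', (rank_lt_of_mem hz).le.trans h3⟩⟩

section Emb

variable {M : Set ZFSet.{u}} (hM : TransClass M) (e : ClassEmb V M)

include hM e

theorem rankLt_iff {y α : ZFSet.{u}} (hy : y ∈ M) (hα : α ∈ M) (ho : α.IsOrdinal) :
    RankLt M y α ↔ rank y < rank α := by
  refine ⟨RankLt.rank_lt hM, fun h => ?_⟩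
  have : FO.{u} (Γ := Fin 0) (fun M _ => ∀ y, y ∈ M → ∀ α, α ∈ M → α.IsOrdinal →
      RankLt M y α ∨ RankGe M y α) :=
    .all (.all (.imp (.ord _) (.or (.rankLt _ _) (.rankGe _ _))))
  have := (this.transfer hM e ![]).1 (fun y _ α _ h => rankLt_or_rankGe h) y hy α hα ho
  exact this.resolve_right fun h' => (h'.rank_le hM).not_gt h

omit e hM in
theorem rankLt_V {y α : ZFSet.{u}} (ho : α.IsOrdinal) : RankLt V y α ↔ rank y < rank α :=
  ⟨RankLt.rank_lt transClass_V, fun h => (rankLt_or_rankGe ho).resolve_right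
    fun h' => (h'.rank_le transClass_V).not_gt h⟩

theorem j_mem_iff {x y : ZFSet.{u}} : e.j x ∈ e.j y ↔ x ∈ y :=
  ((FO.mem (Γ := Fin 2) 0 1).transfer hM e ![x, y]).symm

theorem j_inj {x y : ZFSet.{u}} : e.j x = e.j y ↔ x = y :=
  ((FO.eq (Γ := Fin 2) 0 1).transfer hM e ![x, y]).symm

theorem j_subset_iff {x y : ZFSet.{u}} : e.j x ⊆ e.j y ↔ x ⊆ y :=
  ((FO.subset (Γ := Fin 2) 0 1).transfer hM e ![x, y]).symm

theorem j_ord {x : ZFSet.{u}} (h : x.IsOrdinal) : (e.j x).IsOrdinal :=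
  ((FO.ord (Γ := Fin 1) 0).transfer hM e ![x]).1 h

theorem j_trans {x : ZFSet.{u}} (h : x.IsTransitive) : (e.j x).IsTransitive :=
  ((FO.trans (Γ := Fin 1) 0).transfer hM e ![x]).1 h

theorem j_pair (x y : ZFSet.{u}) : e.j (pair x y) = pair (e.j x) (e.j y) :=
  ((FO.eq_pair (Γ := Fin 3) 0 1 2).transfer hM e ![pair x y, x, y]).1 rfl

theorem pair_mem_class {x y : ZFSet.{u}} (hx : x ∈ M) (hy : y ∈ M) : pair x y ∈ M := by
  have : FO.{u} (Γ := Fin 0) (fun M _ => ∀ x, x ∈ M → ∀ y, y ∈ M → ∃ p, p ∈ M ∧ p = pair x y) :=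
    .all (.all (.ex (.eq_pair _ _ _)))
  obtain ⟨p, hp, rfl⟩ := (this.transfer hM e ![]).1
    (fun x _ y _ => ⟨pair x y, trivial, rfl⟩) x hx y hy
  exact hp

theorem empty_mem_class : (∅ : ZFSet.{u}) ∈ M := by
  have : FO.{u} (Γ := Fin 0) (fun M _ => ∃ x, x ∈ M ∧ ∀ y, y ∈ x → ¬ y = y) :=
    .ex (.ball _ (.not (.eq _ _)))
  obtain ⟨x, hx, h⟩ := (this.transfer hM e ![]).1 ⟨∅, trivial, fun y hy => (notMem_empty _ hy).elim⟩
  have : x = ∅ := (eq_empty x).2 fun y hy => h y hy rfl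
  exact this ▸ hx

theorem j_empty : e.j ∅ = ∅ := by
  have : FO.{u} (Γ := Fin 1) (fun M v => ∀ y, y ∈ v 0 → ¬ y = y) :=
    .ball _ (.not (.eq _ _))
  have := (this.transfer hM e ![∅]).1 (fun y hy => (notMem_empty _ hy).elim)
  exact (eq_empty _).2 fun y hy => this y hy rfl

theorem range_mem_class {f : ZFSet.{u}} (hf : f ∈ M) {r : ZFSet.{u}}
    (hr : ∀ y, y ∈ r ↔ ∃ a, pair a y ∈ f) : r ∈ M := by
  have : FO.{u} (Γ := Fin 0) (fun M _ => ∀ f, f ∈ M → ∃ r, r ∈ M ∧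
      ∀ y, y ∈ M → (y ∈ r ↔ ∃ a, a ∈ M ∧ pair a y ∈ f)) :=
    .all (.ex (.all (.iff (.mem _ _) (.ex (.pair_mem _ _ _)))))
  obtain ⟨r', hr', h⟩ := (this.transfer hM e ![]).1 (fun f _ => by
    obtain ⟨r, hr⟩ := exists_set (P := fun y => ∃ a, pair a y ∈ f) (rank f) (by
      rintro y ⟨a, h⟩
      exact (rank_lt_opair a y).2.trans (rank_lt_of_mem h))
    exact ⟨r, trivial, fun y _ => by simp [hr, V]⟩) f hf
  have : r = r' := by
    ext y
    constructor
    · intro hy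
      obtain ⟨a, ha⟩ := (hr y).1 hy
      have := hM.of_pair_mem ha hf
      exact (h y this.2).2 ⟨a, this.1, ha⟩
    · intro hy
      obtain ⟨a, _, ha⟩ := (h y (hM _ hr' _ hy)).1 hy
      exact (hr y).2 ⟨a, ha⟩
  exact this ▸ hr'

theorem subset_mem_class {θ : ZFSet.{u}} (hc : SeqClosed θ M) {x : ZFSet.{u}}
    (hx : ∀ y ∈ x, y ∈ M) (h : card x ≤ card θ) : x ∈ M := by
  rcases x.eq_empty_or_nonempty with rfl | hne
  · exact empty_mem_class hM e
  obtain ⟨F, hF, hF'⟩ := exists_surj_of_card_le hne h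
  refine range_mem_class hM e (f := gr θ F) (hc _ ⟨?_, ?_⟩) ?_
  · intro p hp
    obtain ⟨a, ha, rfl⟩ := mem_gr.1 hp
    exact ⟨a, F a, ha, hx _ (hF a ha), rfl⟩
  · intro a ha
    exact ⟨F a, pair_mem_gr.2 ⟨ha, rfl⟩, fun b hb => (pair_mem_gr.1 hb).2⟩
  · intro y
    constructor
    · intro hy
      obtain ⟨a, ha, rfl⟩ := hF' y hy
      exact ⟨a, pair_mem_gr.2 ⟨ha, rfl⟩⟩
    · rintro ⟨a, hp⟩
      obtain ⟨ha, rfl⟩ := pair_mem_gr.1 hp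
      exact hF a ha

theorem trans_subset_class {θ : ZFSet.{u}} (hc : SeqClosed θ M) {Y : ZFSet.{u}}
    (hY : Y.IsTransitive) (h : card Y ≤ card θ) : ∀ y ∈ Y, y ∈ M := by
  intro y
  induction y using ZFSet.inductionOn with
  | _ y ih =>
    intro hy
    exact subset_mem_class hM e hc (fun z hz => ih z hz (hY.subset_of_mem hy hz))
      ((card_mono (hY.subset_of_mem hy)).trans h)

theorem seqClosed_mono {θ θ₀ : ZFSet.{u}} (hc : SeqClosed θ M) (h : card θ₀ ≤ card θ)
    (h0 : ∀ a ∈ θ₀, a ∈ M) : SeqClosed θ₀ M := by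
  intro f hf
  refine subset_mem_class hM e hc ?_ (le_trans ?_ h)
  · intro p hp
    obtain ⟨a, b, ha, hb, rfl⟩ := hf.1 p hp
    exact pair_mem_class hM e (h0 a ha) hb
  · classical
    refine card_le_of_surj (fun a => if h : ∃ b, pair a b ∈ f then pair a h.choose else ∅) ?_
    intro p hp
    obtain ⟨a, b, ha, hb, rfl⟩ := hf.1 p hp
    refine ⟨a, ha, ?_⟩
    have hex : ∃ b, pair a b ∈ f := ⟨b, hp⟩
    rw [dif_pos hex, (hf.2 a ha).unique hex.choose_spec hp]

theorem mem_j_V {α y : ZFSet.{u}} (hα : α.IsOrdinal) (hy : y ∈ M) :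
    y ∈ e.j (V_ (rank α)) ↔ rank y < rank (e.j α) := by
  have : FO.{u} (Γ := Fin 2) (fun M v => ∀ y, y ∈ M → (y ∈ v 0 ↔ RankLt M y (v 1))) :=
    .all (.iff (.mem _ _) (.rankLt _ _))
  have := (this.transfer hM e ![V_ (rank α), α]).1
    (fun y _ => by rw [rankLt_V (by exact hα)]; exact mem_vonNeumann) y hy
  exact this.trans (rankLt_iff hM e hy (e.maps _ trivial) (j_ord hM e hα))

theorem rank_lt_j {x α : ZFSet.{u}} (hα : α.IsOrdinal) (h : rank x < rank α) :
    rank (e.j x) < rank (e.j α) := by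
  rw [← mem_j_V hM e hα (e.maps _ trivial), j_mem_iff hM e]
  exact mem_vonNeumann.2 h

end Emb

theorem FO.eq_insert {Γ : Type} (b a : Γ) : FO.{u} (fun _ v => v b = insert (v a) (v a)) := by
  have : FO.{u} (fun _ (v : Γ → ZFSet.{u}) => v a ∈ v b ∧ v a ⊆ v b ∧
      ∀ x, x ∈ v b → x = v a ∨ x ∈ v a) :=
    (mem _ _).and ((subset _ _).and (ball _ ((eq _ _).or (mem _ _))))
  refine this.congr fun M hM v => ?_
  constructor
  · intro H
    simp only [H]
    exact ⟨by simp, fun x hx => by simp [hx], fun x hx => by simpa using hx⟩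
  · rintro ⟨h1, h2, h3⟩
    ext x
    rw [ZFSet.mem_insert_iff]
    exact ⟨h3 x, by rintro (rfl | hx); exacts [h1, h2 hx]⟩

/-- The ordinal `ω` as a set. -/
noncomputable def om : ZFSet.{u} := (ω : Ordinal.{u}).toZFSet

theorem mem_om {x : ZFSet.{u}} : x ∈ om ↔ ∃ n : ℕ, x = (n : Ordinal.{u}).toZFSet := by
  rw [om, mem_toZFSet_iff]
  constructor
  · rintro ⟨a, ha, rfl⟩
    obtain ⟨n, rfl⟩ := lt_omega0.1 ha
    exact ⟨n, rfl⟩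
  · rintro ⟨n, rfl⟩
    exact ⟨n, natCast_lt_omega0 n, rfl⟩

theorem om_ord : om.{u}.IsOrdinal := isOrdinal_toZFSet _

theorem rank_om : rank om.{u} = ω := rank_toZFSet _

section Crit

variable {M : Set ZFSet.{u}} (hM : TransClass M) (e : ClassEmb V M) {κ : ZFSet.{u}}
  (hc : CritPt e.j κ)

include hM hc

theorem crit_succ_mem {α : ZFSet.{u}} (hα : α ∈ κ) : insert α α ∈ κ := by
  have ho := hc.1
  have hs := isOrdinal_succ (ho.mem hα)
  rcases hs.mem_trichotomous ho with h | h | h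
  · exact h
  · exfalso
    have := ((FO.eq_insert (Γ := Fin 2) 0 1).transfer hM e ![κ, α]).1 h.symm
    have h2 : e.j κ = insert (e.j α) (e.j α) := this
    rw [hc.2.2 α (ho.mem hα) hα, h] at h2
    have := hc.2.1
    rw [h2] at this
    exact mem_irrefl _ this
  · rcases (mem_insert_iff.1 h) with rfl | h
    · exact (mem_irrefl _ hα).elim
    · exact (mem_asymm h hα).elim

theorem crit_empty_mem : ∅ ∈ κ := by
  rcases isOrdinal_empty.mem_trichotomous hc.1 with h | h | h
  · exact h
  · have := hc.2.1
    rw [← h, j_empty hM e] at this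
    exact (notMem_empty _ this).elim
  · exact (notMem_empty _ h).elim

theorem crit_limit : Order.IsSuccLimit (rank κ) := by
  rw [Order.isSuccLimit_iff, Order.isSuccPrelimit_iff_succ_lt]
  constructor
  · rw [isMin_iff_eq_bot]
    intro h
    have := rank_lt_of_mem (crit_empty_mem hM e hc)
    rw [h] at this
    exact not_lt_bot this
  · intro a ha
    have h1 : a.toZFSet ∈ κ := by
      rw [← hc.1.toZFSet_rank_eq]; exact toZFSet_mem_toZFSet_iff.2 ha
    have := rank_lt_of_mem (crit_succ_mem hM e hc h1)
    rwa [← toZFSet_add_one, rank_toZFSet] at this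

theorem om_mem_crit : om ∈ κ := by
  have hlim := crit_limit hM e hc
  have h1 : om ⊆ κ := by
    rw [← IsOrdinal.rank_le_iff_subset om_ord hc.1, rank_om]
    exact omega0_le_of_isSuccLimit hlim
  rcases (IsOrdinal.subset_iff_eq_or_mem om_ord hc.1).1 h1 with h | h
  · exfalso
    have : FO.{u} (Γ := Fin 1) (fun M v => ∀ x, x ∈ v 0 → (∀ y, y ∈ x → ¬ y = y) ∨
        ∃ y, y ∈ x ∧ x = insert y y) :=
      .ball _ (.or (.ball _ (.not (.eq _ _))) (.bex _ (.eq_insert _ _)))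
    have := (this.transfer hM e ![om]).1 (fun x hx => by
      obtain ⟨n, rfl⟩ := mem_om.1 hx
      rcases n with - | n
      · left; intro y hy; simp at hy
      · right
        refine ⟨(n : Ordinal).toZFSet, ?_, ?_⟩
        · rw [toZFSet_mem_toZFSet_iff]; exact_mod_cast Nat.lt_succ_self n
        · rw [← toZFSet_add_one]; simp)
    have hcr := hc.2.1
    rw [← h] at hcr
    rcases this om hcr with h' | ⟨y, hy, h'⟩
    · exact h' ∅ (h ▸ crit_empty_mem hM e hc) rfl
    · rw [h'] at h
      rw [h] at h'
      have := crit_succ_mem hM e hc (h ▸ mem_insert y y)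
      rw [h] at this
      exact mem_irrefl _ this
  · exact h

theorem j_fix {x : ZFSet.{u}} (hx : rank x < rank κ) : e.j x = x := by
  have hlim := crit_limit hM e hc
  have main : ∀ o : Ordinal.{u}, ∀ x : ZFSet.{u}, rank x = o → rank x < rank κ → e.j x = x := by
    intro o
    induction o using WellFoundedLT.induction with
    | _ o ih =>
      rintro x rfl hx
      have ho : (Order.succ (rank x)).toZFSet.IsOrdinal := isOrdinal_toZFSet _
      have hs : (Order.succ (rank x)).toZFSet ∈ κ :=
        mem_of_rank_lt ho hc.1 (by rw [rank_toZFSet]; exact hlim.succ_lt hx)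
      have hr : rank (e.j x) ≤ rank x := by
        have := rank_lt_j hM e (x := x) ho (by rw [rank_toZFSet]; exact Order.lt_succ _)
        rw [hc.2.2 _ ho hs, rank_toZFSet] at this
        exact Order.lt_succ_iff.1 this
      ext y
      constructor
      · intro hy
        have hy' := (rank_lt_of_mem hy).trans_le hr
        rw [← ih _ hy' y rfl (hy'.trans hx)] at hy
        exact (j_mem_iff hM e).1 hy
      · intro hy
        have hy' := rank_lt_of_mem hy
        rw [← ih _ hy' y rfl (hy'.trans hx)]
        exact (j_mem_iff hM e).2 hy
  exact main _ x rfl hx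

end Crit

end LaverDiamond

namespace LaverDiamond

open ZFSet Ordinal Filter

/-- Any set, as an element of the universe. -/
def vel (x : ZFSet.{u}) : V.{u} := ⟨x, trivial⟩

theorem vel_inj {x y : ZFSet.{u}} : vel x = vel y ↔ x = y := Subtype.ext_iff

/-- A family of functions on `I` to be used for an ultrapower by `U`: it is closed under
finitary operations and its internal membership relation is well-founded. -/
structure UltraFamily (I : Type (u + 1)) (U : Ultrafilter I) where
  Fn : Set (I → ZFSet.{u})
  comp : ∀ (n : ℕ) (h : Fin n → I → ZFSet.{u}), (∀ k, h k ∈ Fn) →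
    ∀ F : (Fin n → ZFSet.{u}) → ZFSet.{u}, (fun s => F (fun k => h k s)) ∈ Fn
  wf : ∀ h : ℕ → I → ZFSet.{u}, (∀ n, h n ∈ Fn) → ¬ ∀ n, ∀ᶠ s in U, h (n + 1) s ∈ h n s

namespace UltraFamily

variable {I : Type (u + 1)} {U : Ultrafilter I} (W : UltraFamily I U)

theorem comp' {ι : Type} [Finite ι] (h : ι → W.Fn) (F : (ι → ZFSet.{u}) → ZFSet.{u}) :
    (fun s => F (fun k => (h k).1 s)) ∈ W.Fn := by
  obtain ⟨n, ⟨f⟩⟩ := Finite.exists_equiv_fin ι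
  have := W.comp n (fun k => h (f.symm k)) (fun k => (h _).2) (fun v => F (fun k => v (f k)))
  simpa using this

theorem const_mem (a : ZFSet.{u}) : (fun _ => a) ∈ W.Fn :=
  W.comp 0 (fun k => k.elim0) (fun k => k.elim0) (fun _ => a)

/-- The constant function, as an element of the family. -/
def cst (a : ZFSet.{u}) : W.Fn := ⟨fun _ => a, W.const_mem a⟩

theorem map₂_mem (g h : W.Fn) (F : ZFSet.{u} → ZFSet.{u} → ZFSet.{u}) :
    (fun s => F (g.1 s) (h.1 s)) ∈ W.Fn :=
  W.comp' (ι := Bool) (fun b => if b then g else h) (fun v => F (v true) (v false))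

/-- Almost everywhere equality on the family. -/
def aeSetoid : Setoid W.Fn where
  r g h := ∀ᶠ s in U, g.1 s = h.1 s
  iseqv := ⟨fun _ => Eventually.of_forall fun _ => rfl, fun h => h.mono fun _ h => h.symm,
    fun h h' => (h.and h').mono fun _ h => h.1.trans h.2⟩

/-- The ultrapower as a type. -/
def Pow : Type (u + 1) := Quotient W.aeSetoid

/-- The class of a function in the ultrapower. -/
def cls (h : W.Fn) : W.Pow := Quotient.mk W.aeSetoid h

theorem cls_eq {g h : W.Fn} : W.cls g = W.cls h ↔ ∀ᶠ s in U, g.1 s = h.1 s :=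
  Quotient.eq (r := W.aeSetoid)

theorem exists_cls (p : W.Pow) : ∃ h, W.cls h = p := Quotient.exists_rep p

/-- The membership relation of the ultrapower. -/
def E (p q : W.Pow) : Prop := ∃ g h : W.Fn, W.cls g = p ∧ W.cls h = q ∧ ∀ᶠ s in U, g.1 s ∈ h.1 s

theorem E_cls {g h : W.Fn} : W.E (W.cls g) (W.cls h) ↔ ∀ᶠ s in U, g.1 s ∈ h.1 s := by
  constructor
  · rintro ⟨g', h', e, e', H⟩
    filter_upwards [W.cls_eq.1 e, W.cls_eq.1 e', H] with s h1 h2 h3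
    rwa [← h1, ← h2]
  · intro H; exact ⟨g, h, rfl, rfl, H⟩

theorem E_wf : WellFounded W.E := by
  rw [wellFounded_iff_isEmpty_descending_chain]
  refine ⟨fun ⟨f, hf⟩ => ?_⟩
  choose h hh using fun n => W.exists_cls (f n)
  refine W.wf (fun n => (h n).1) (fun n => (h n).2) fun n => ?_
  rw [← W.E_cls, hh, hh]
  exact hf n

theorem small_E [Small.{u} I] (q : W.Pow) : Small.{u} {p : W.Pow // W.E p q} := by
  obtain ⟨h, rfl⟩ := W.exists_cls q
  have key : ∀ p : {p : W.Pow // W.E p (W.cls h)},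
      ∃ k : W.Fn, W.cls k = p.1 ∧ ∀ s, k.1 s ∈ insert ∅ (h.1 s) := by
    rintro ⟨p, hp⟩
    obtain ⟨g, rfl⟩ := W.exists_cls p
    classical
    refine ⟨⟨_, W.map₂_mem g h (fun x y => if x ∈ y then x else ∅)⟩, ?_, fun s => ?_⟩
    · rw [cls_eq]
      filter_upwards [W.E_cls.1 hp] with s hs
      simp [hs]
    · dsimp only
      split_ifs with h'
      · simpa using Or.inr h'
      · simp
  choose k hk hk' using key
  refine small_of_injective (β := ∀ s : I, ((insert ∅ (h.1 s) : ZFSet.{u}) : Type (u + 1)))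
    (f := fun p s => ⟨(k p).1 s, hk' p s⟩) ?_
  intro p p' e
  apply Subtype.ext
  rw [← hk, ← hk, cls_eq]
  refine Eventually.of_forall fun s => ?_
  exact congrArg Subtype.val (congrFun e s)

/-- The Mostowski collapse of the ultrapower. -/
noncomputable def collapse [Small.{u} I] : W.Pow → ZFSet.{u} :=
  W.E_wf.fix fun q f =>
    have := W.small_E q
    ZFSet.range (fun p : {p : W.Pow // W.E p q} => f p.1 p.2)

variable [Small.{u} I]

theorem mem_collapse {x : ZFSet.{u}} {q : W.Pow} :
    x ∈ W.collapse q ↔ ∃ p, W.E p q ∧ W.collapse p = x := by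
  rw [collapse, WellFounded.fix_eq]
  have := W.small_E q
  rw [ZFSet.mem_range]
  simp

omit [Small.{u} I] in
theorem E_ext {p q : W.Pow} (H : ∀ r, W.E r p ↔ W.E r q) : p = q := by
  obtain ⟨g, rfl⟩ := W.exists_cls p
  obtain ⟨h, rfl⟩ := W.exists_cls q
  by_contra hne
  rw [cls_eq, ← Ultrafilter.eventually_not] at hne
  have key : ∀ x y : ZFSet.{u}, ∃ z, x ≠ y → ¬ (z ∈ x ↔ z ∈ y) := by
    intro x y
    by_cases hxy : x = y
    · exact ⟨∅, fun h => (h hxy).elim⟩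
    · by_contra hcon
      push Not at hcon
      exact hxy (ZFSet.ext fun z => (hcon z).2)
  choose F hF using key
  let k : W.Fn := ⟨_, W.map₂_mem g h F⟩
  have hk : ∀ s, k.1 s = F (g.1 s) (h.1 s) := fun s => rfl
  have := H (W.cls k)
  rw [E_cls, E_cls] at this
  by_cases h1 : ∀ᶠ s in U, k.1 s ∈ g.1 s
  · obtain ⟨s, a, b, c⟩ := (hne.and (h1.and (this.1 h1))).exists
    rw [hk] at b c
    exact hF _ _ a ⟨fun _ => c, fun _ => b⟩
  · have h2 := mt this.2 h1
    rw [← Ultrafilter.eventually_not] at h1 h2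
    obtain ⟨s, a, b, c⟩ := (hne.and (h1.and h2)).exists
    rw [hk] at b c
    exact hF _ _ a ⟨fun h => (b h).elim, fun h => (c h).elim⟩

theorem collapse_inj {p q : W.Pow} (h : W.collapse p = W.collapse q) : p = q := by
  induction p using W.E_wf.induction generalizing q with
  | _ p ih =>
    apply W.E_ext
    intro r
    constructor
    · intro hr
      obtain ⟨r', hr', e⟩ := W.mem_collapse.1 (h ▸ W.mem_collapse.2 ⟨r, hr, rfl⟩)
      rwa [ih r hr e.symm]
    · intro hr
      obtain ⟨r', hr', e⟩ := W.mem_collapse.1 (h.symm ▸ W.mem_collapse.2 ⟨r, hr, rfl⟩)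
      rwa [← ih r' hr' e]

/-- The set represented by a function in the collapsed ultrapower. -/
noncomputable def mos (h : W.Fn) : ZFSet.{u} := W.collapse (W.cls h)

theorem mos_mem {g h : W.Fn} : W.mos g ∈ W.mos h ↔ ∀ᶠ s in U, g.1 s ∈ h.1 s := by
  rw [mos, mos, mem_collapse, ← E_cls]
  constructor
  · rintro ⟨p, hp, e⟩; rwa [← W.collapse_inj e]
  · intro h; exact ⟨_, h, rfl⟩

theorem mos_eq {g h : W.Fn} : W.mos g = W.mos h ↔ ∀ᶠ s in U, g.1 s = h.1 s := by
  rw [← cls_eq]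
  exact ⟨fun e => W.collapse_inj e, fun e => by rw [mos, mos, e]⟩

theorem mem_mos {x : ZFSet.{u}} {h : W.Fn} :
    x ∈ W.mos h ↔ ∃ g, W.mos g = x ∧ ∀ᶠ s in U, g.1 s ∈ h.1 s := by
  rw [mos, mem_collapse]
  constructor
  · rintro ⟨p, hp, rfl⟩
    obtain ⟨g, rfl⟩ := W.exists_cls p
    exact ⟨g, rfl, W.E_cls.1 hp⟩
  · rintro ⟨g, rfl, hg⟩
    exact ⟨_, W.E_cls.2 hg, rfl⟩

/-- The collapsed ultrapower. -/
def Ult : Set ZFSet.{u} := Set.range W.mos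

theorem trans_Ult : TransClass W.Ult := by
  rintro _ ⟨h, rfl⟩ y hy
  obtain ⟨g, rfl, _⟩ := W.mem_mos.1 hy
  exact ⟨g, rfl⟩

/-- The element of the ultrapower represented by a function. -/
noncomputable def el (h : W.Fn) : W.Ult := ⟨W.mos h, h, rfl⟩

omit [Small.{u} I] in
theorem exists_term {β : Type} (t : SetLang.Term β) : ∃ b, t = Language.Term.var b := by
  cases t with
  | var b => exact ⟨b, rfl⟩
  | func f ts => exact Empty.elim f

theorem los {α : Type} [Finite α] {n : ℕ} (φ : SetLang.BoundedFormula α n) (h : α → W.Fn)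
    (k : Fin n → W.Fn) :
    φ.Realize (M := W.Ult) (fun a => W.el (h a)) (fun i => W.el (k i)) ↔
      ∀ᶠ s in U, φ.Realize (M := V.{u}) (fun a => vel ((h a).1 s))
        (fun i => vel ((k i).1 s)) := by
  have hel : ∀ {n : ℕ} (k : Fin n → W.Fn) (b : α ⊕ Fin n),
      Sum.elim (fun a => W.el (h a)) (fun i => W.el (k i)) b = W.el (Sum.elim h k b) := by
    intro n k b; cases b <;> rfl
  have hV : ∀ {n : ℕ} (k : Fin n → W.Fn) (b : α ⊕ Fin n) (s : I),
      Sum.elim (fun a => vel ((h a).1 s)) (fun i => vel ((k i).1 s)) b =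
        vel ((Sum.elim h k b).1 s) := by
    intro n k b s; cases b <;> rfl
  induction φ with
  | falsum =>
    constructor
    · intro h; exact h.elim
    · intro h; exact h.exists.choose_spec.elim
  | @equal n t₁ t₂ =>
    obtain ⟨b₁, rfl⟩ := exists_term t₁
    obtain ⟨b₂, rfl⟩ := exists_term t₂
    simp only [Language.BoundedFormula.Realize, Language.Term.realize_var, hel, hV]
    simp only [vel_inj]
    exact Subtype.ext_iff.trans W.mos_eq
  | @rel n l R ts =>
    change memRel l at R
    cases R
    obtain ⟨b₁, h₁⟩ := exists_term (ts 0)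
    obtain ⟨b₂, h₂⟩ := exists_term (ts 1)
    change ((((ts 0).realize _ : W.Ult) : ZFSet) ∈ (((ts 1).realize _ : W.Ult) : ZFSet)) ↔
      ∀ᶠ s in (U : Filter I), ((((ts 0).realize _ : V.{u}) : ZFSet) ∈ (((ts 1).realize _ : V.{u}) : ZFSet))
    simp only [h₁, h₂, Language.Term.realize_var, hel, hV]
    exact W.mos_mem
  | imp φ ψ ih₁ ih₂ =>
    simp only [Language.BoundedFormula.realize_imp]
    exact (imp_congr (ih₁ k) (ih₂ k)).trans Ultrafilter.eventually_imp.symm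
  | @all n φ ih =>
    have hsn : ∀ g : W.Fn, (Fin.snoc (fun i => W.el (k i)) (W.el g) : Fin (n + 1) → W.Ult) =
        fun i => W.el ((Fin.snoc k g : Fin (n + 1) → W.Fn) i) := by
      intro g; funext i
      refine Fin.lastCases ?_ (fun i => ?_) i <;> simp
    have hsV : ∀ (g : W.Fn) (s : I), (Fin.snoc (fun i => vel ((k i).1 s))
        (vel (g.1 s)) : Fin (n + 1) → V.{u}) =
        fun i => vel (((Fin.snoc k g : Fin (n + 1) → W.Fn) i).1 s) := by
      intro g s; funext i
      refine Fin.lastCases ?_ (fun i => ?_) i <;> simp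
    simp only [Language.BoundedFormula.realize_all]
    constructor
    · intro H
      by_contra hcon
      rw [← Ultrafilter.eventually_not] at hcon
      classical
      let F : (α ⊕ Fin n → ZFSet.{u}) → ZFSet.{u} := fun v =>
        if hx : ∃ a : V.{u}, ¬ φ.Realize (M := V.{u}) (fun a => vel (v (Sum.inl a)))
          (Fin.snoc (fun i => vel (v (Sum.inr i))) a) then (hx.choose : ZFSet.{u}) else ∅
      let g : W.Fn := ⟨_, W.comp' (ι := α ⊕ Fin n) (Sum.elim h k) F⟩
      have := H (W.el g)
      rw [hsn] at this
      replace this := (ih _).1 this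
      obtain ⟨s, h1, h2⟩ := (hcon.and this).exists
      rw [← hsV] at h2
      push Not at h1
      have hg : vel (g.1 s) = h1.choose := by
        apply Subtype.ext
        exact dif_pos h1
      rw [hg] at h2
      exact h1.choose_spec h2
    · rintro H ⟨_, g, rfl⟩
      change φ.Realize _ (Fin.snoc _ (W.el g))
      rw [hsn]
      refine (ih _).2 ?_
      filter_upwards [H] with s hs
      have := hs (vel (g.1 s))
      rwa [hsV] at this

theorem fo_los {n : ℕ} {P : Set ZFSet.{u} → (Fin n → ZFSet.{u}) → Prop} (hP : FO P)
    (h : Fin n → W.Fn) : P W.Ult (fun i => W.mos (h i)) ↔ ∀ᶠ s in U, P V (fun i => (h i).1 s) := by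
  obtain ⟨φ, hφ⟩ := hP
  have h1 := hφ _ W.trans_Ult (fun i => W.el (h i))
  have h2 := fun s => hφ _ transClass_V (fun i => vel ((h i).1 s))
  refine h1.symm.trans (Iff.trans ?_ (eventually_congr (Eventually.of_forall h2)))
  have := W.los φ h (fun i => i.elim0)
  rw [show (fun i : Fin 0 => W.el i.elim0) = default from Subsingleton.elim _ _] at this
  refine this.trans (eventually_congr (Eventually.of_forall fun s => ?_))
  rw [Language.Formula.Realize]
  exact iff_of_eq (congrArg _ (Subsingleton.elim _ _))

/-- The ultrapower embedding. -/
noncomputable def emb : ClassEmb V.{u} W.Ult where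
  j a := W.mos (W.cst a)
  maps a _ := ⟨_, rfl⟩
  elem {n} φ v hv := by
    have := W.los φ (fun i => W.cst (v i)) (fun i => i.elim0)
    rw [show (fun i : Fin 0 => W.el i.elim0) = default from Subsingleton.elim _ _] at this
    refine Iff.trans ?_ this.symm
    rw [Language.Formula.Realize]
    change _ ↔ ∀ᶠ s in (U : Filter I), Language.BoundedFormula.Realize (M := V.{u}) φ (fun a => vel (v a))
      (fun i : Fin 0 => vel ((i.elim0 : W.Fn).1 s))
    have hd : ∀ s : I, (fun i : Fin 0 => vel ((i.elim0 : W.Fn).1 s)) = default :=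
      fun s => Subsingleton.elim _ _
    simp only [hd]
    exact (eventually_const (f := (U : Filter I))).symm

theorem emb_j (a : ZFSet.{u}) : W.emb.j a = W.mos (W.cst a) := rfl

end UltraFamily

end LaverDiamond

namespace LaverDiamond

open ZFSet Ordinal Filter

/-- `x` looks like (the pre-image of) the restriction to `Y` of a supercompactness embedding
whose Laver function `r` guesses `A`. -/
def Guess (x Y δ θ A r : ZFSet.{u}) : Prop :=
  (∀ p, p ∈ x → ∃ a, a ∈ Y ∧ ∃ b, b ∈ Y ∧ p = pair a b) ∧
  (∀ a, a ∈ Y → ∀ b, b ∈ Y → pair a b ∈ x →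
    (∀ a', a' ∈ Y → ∀ b', b' ∈ Y → pair a' b' ∈ x → ((a = a' ↔ b = b') ∧ (a ∈ a' ↔ b ∈ b'))) ∧
    (∀ a', a' ∈ a → ∃ b', b' ∈ Y ∧ pair a' b' ∈ x) ∧
    (b ∈ δ → a = b)) ∧
  (∀ a, a ∈ Y → pair a θ ∈ x → a ∈ δ) ∧
  (∀ a, a ∈ Y → pair a δ ∈ x → ∀ b, b ∈ Y → pair b A ∈ x → pair a b ∈ r ∧ a ∈ δ)

theorem FO.guess {Γ : Type} (x Y δ θ A r : Γ) :
    FO.{u} (fun _ v => Guess (v x) (v Y) (v δ) (v θ) (v A) (v r)) :=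
  .and (.ball _ (.bex _ (.bex _ (.eq_pair _ _ _))))
  (.and (.ball _ (.ball _ (.imp (.pair_mem _ _ _)
    (.and (.ball _ (.ball _ (.imp (.pair_mem _ _ _)
      (.and (.iff (.eq _ _) (.eq _ _)) (.iff (.mem _ _) (.mem _ _))))))
    (.and (.ball _ (.bex _ (.pair_mem _ _ _))) (.imp (.mem _ _) (.eq _ _)))))))
  (.and (.ball _ (.imp (.pair_mem _ _ _) (.mem _ _)))
  (.ball _ (.imp (.pair_mem _ _ _) (.ball _ (.imp (.pair_mem _ _ _)
    (.and (.pair_mem _ _ _) (.mem _ _))))))))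

/-- In the sense of `M`, `U` generates a fine normal ultrafilter on the set `I` of
guesses. -/
def Meas (M : Set ZFSet.{u}) (I U Y δ θ A r : ZFSet.{u}) : Prop :=
  (∀ x, x ∈ I → Guess x Y δ θ A r) ∧
  (∀ X, X ∈ U → X ⊆ I) ∧
  (∀ X, X ∈ U → ∀ X', X' ∈ U → ∃ X'', X'' ∈ U ∧ (X'' ⊆ X ∧ X'' ⊆ X')) ∧
  (∀ X, X ∈ U → ∃ x, x ∈ X ∧ x = x) ∧
  (∀ X, X ∈ M → X ⊆ I → ∃ X', X' ∈ U ∧ (X' ⊆ X ∨ ∀ x, x ∈ X' → ¬ x ∈ X)) ∧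
  (∀ y, y ∈ Y → ∃ X, X ∈ U ∧ ∀ x, x ∈ X → ∃ a, a ∈ Y ∧ pair a y ∈ x) ∧
  (∀ X, X ∈ U → ∀ g, g ∈ M →
    (∀ x, x ∈ X → ∃ a, a ∈ Y ∧ ∃ b, b ∈ Y ∧ (pair a b ∈ x ∧ pair x b ∈ g)) →
    ∃ y, y ∈ Y ∧ ∃ X', X' ∈ U ∧ ∀ x, x ∈ X' → pair x y ∈ g)

theorem FO.meas {Γ : Type} (I U Y δ θ A r : Γ) :
    FO.{u} (fun M v => Meas M (v I) (v U) (v Y) (v δ) (v θ) (v A) (v r)) :=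
  .and (.ball _ (.guess _ _ _ _ _ _))
  (.and (.ball _ (.subset _ _))
  (.and (.ball _ (.ball _ (.bex _ (.and (.subset _ _) (.subset _ _)))))
  (.and (.ball _ (.bex _ (.eq _ _)))
  (.and (.all (.imp (.subset _ _) (.bex _ (.or (.subset _ _) (.ball _ (.not (.mem _ _)))))))
  (.and (.ball _ (.bex _ (.ball _ (.bex _ (.pair_mem _ _ _)))))
  (.ball _ (.all (.imp
    (.ball _ (.bex _ (.bex _ (.and (.pair_mem _ _ _) (.pair_mem _ _ _)))))
    (.bex _ (.bex _ (.ball _ (.pair_mem _ _ _))))))))))))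

theorem Guess.mono {x Y δ θ A r r' : ZFSet.{u}} (h : Guess x Y δ θ A r)
    (hr : ∀ a b, a ∈ δ → pair a b ∈ r → pair a b ∈ r') : Guess x Y δ θ A r' := by
  obtain ⟨h1, h2, h3, h4⟩ := h
  refine ⟨h1, h2, h3, fun a ha hp b hb hp' => ?_⟩
  obtain ⟨h5, h6⟩ := h4 a ha hp b hb hp'
  exact ⟨hr _ _ h6 h5, h6⟩

theorem Meas.mono {M : Set ZFSet.{u}} {I U Y δ θ A r r' : ZFSet.{u}} (h : Meas M I U Y δ θ A r)
    (hr : ∀ a b, a ∈ δ → pair a b ∈ r → pair a b ∈ r') : Meas M I U Y δ θ A r' :=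
  ⟨fun x hx => (h.1 x hx).mono hr, h.2⟩

/-- If `M` contains all sets of small rank then being a measure is upwards absolute. -/
theorem Meas.to_V {M : Set ZFSet.{u}} {I U Y δ θ A r : ZFSet.{u}} (h : Meas M I U Y δ θ A r)
    {γ : Ordinal.{u}} (hγ : Order.IsSuccLimit γ) (hY : rank Y < γ)
    (hM : ∀ x, rank x < γ → x ∈ M) : Meas V I U Y δ θ A r := by
  obtain ⟨h1, h2, h3, h4, h5, h6, h7⟩ := h
  have hI : rank I < γ := by
    have : ∀ x ∈ I, rank x ≤ Order.succ (Order.succ (rank Y)) := by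
      intro x hx
      rw [rank_le_iff]
      intro p hp
      obtain ⟨a, ha, b, hb, rfl⟩ := (h1 x hx).1 p hp
      rw [rank_opair]
      simp only [Order.succ_lt_succ_iff]
      exact max_lt (rank_lt_of_mem ha) (rank_lt_of_mem hb)
    refine (rank_le_iff.2 fun x hx => Order.lt_succ_iff.2 (this x hx)).trans_lt ?_
    exact hγ.succ_lt (hγ.succ_lt (hγ.succ_lt hY))
  refine ⟨h1, h2, h3, h4, ?_, h6, ?_⟩
  · intro X _ hX
    exact h5 X (hM _ ((rank_mono hX).trans_lt hI)) hX
  · intro X hX g _ hg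
    let g' := ZFSet.sep (fun p => p ∈ g) (ZFSet.prod I Y)
    have hg' : ∀ x y, pair x y ∈ g' ↔ x ∈ I ∧ y ∈ Y ∧ pair x y ∈ g := by
      intro x y
      rw [ZFSet.mem_sep, pair_mem_prod]; tauto
    have hgM : g' ∈ M := by
      apply hM
      have hm : max (rank I) (rank Y) < γ := max_lt hI hY
      refine lt_of_le_of_lt (b := Order.succ (Order.succ (max (rank I) (rank Y)))) ?_
        (hγ.succ_lt (hγ.succ_lt hm))
      rw [rank_le_iff]
      intro p hp
      obtain ⟨a, ha, b, hb, rfl⟩ := mem_prod.1 (ZFSet.mem_sep.1 hp).1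
      rw [rank_opair]
      simp only [Order.succ_lt_succ_iff]
      exact max_lt_max (rank_lt_of_mem ha) (rank_lt_of_mem hb)
    obtain ⟨y, hy, X', hX', h'⟩ := h7 X hX g' hgM (fun x hx => by
      obtain ⟨a, ha, b, hb, hp, hp'⟩ := hg x hx
      exact ⟨a, ha, b, hb, hp, (hg' _ _).2 ⟨h2 X hX hx, hb, hp'⟩⟩)
    exact ⟨y, hy, X', hX', fun x hx => ((hg' _ _).1 (h' x hx)).2.2⟩

/-- Deriving a measure from a supercompactness embedding. -/
theorem exists_meas {δ θ₁ : ZFSet.{u}} (E : SCEmb δ θ₁) {Y θ A r : ZFSet.{u}}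
    (hY : Y.IsTransitive) (hθ : θ ∈ Y) (hθo : θ.IsOrdinal)
    (hθ₁ : θ₁.IsOrdinal) (hcard : card Y ≤ card θ₁) (hrank : rank Y < rank θ₁)
    (hV : ∀ y, rank y < rank δ → y ∈ Y)
    (hr : pair δ A ∈ E.e.j r) : ∃ I U, Meas V I U Y δ θ A r := by
  obtain ⟨M, hM, e, hc, hcl, hbig⟩ := E
  dsimp only at hr
  have hYM := trans_subset_class hM e hcl hY hcard
  have hsM : gr Y e.j ∈ M := by
    refine subset_mem_class hM e hcl ?_ ((card_le_of_surj (fun a => pair a (e.j a)) ?_).trans hcard)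
    · intro p hp
      obtain ⟨a, ha, rfl⟩ := mem_gr.1 hp
      exact pair_mem_class hM e (hYM a ha) (e.maps _ trivial)
    · intro p hp
      obtain ⟨a, ha, rfl⟩ := mem_gr.1 hp
      exact ⟨a, ha, rfl⟩
  set s := gr Y e.j with hs
  have hps : ∀ {a b}, pair a b ∈ s ↔ a ∈ Y ∧ b = e.j a := pair_mem_gr
  have hjm := fun {x y} => j_mem_iff hM e (x := x) (y := y)
  have hj : ∀ a ∈ Y, a ∈ e.j Y := by
    have : FO.{u} (Γ := Fin 2) (fun M v => ∀ y, y ∈ M → RankLt M y (v 0) → y ∈ v 1) :=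
      .all (.imp (.rankLt _ _) (.mem _ _))
    intro a ha
    refine (this.transfer hM e ![δ, Y]).1 (fun y _ h => hV y ((rankLt_V hc.1).1 h)) a (hYM a ha) ?_
    exact (rankLt_iff hM e (hYM a ha) (e.maps _ trivial) (j_ord hM e hc.1)).2
      (((rank_lt_of_mem ha).trans hrank).trans (rank_lt_of_mem hbig))
  have hguess : Guess s (e.j Y) (e.j δ) (e.j θ) (e.j A) (e.j r) := by
    refine ⟨?_, ?_, ?_, ?_⟩
    · intro p hp
      obtain ⟨a, ha, rfl⟩ := mem_gr.1 hp
      exact ⟨a, hj a ha, _, hjm.2 ha, rfl⟩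
    · intro a _ b _ hp
      obtain ⟨ha, rfl⟩ := hps.1 hp
      refine ⟨?_, ?_, ?_⟩
      · intro a' _ b' _ hp'
        obtain ⟨ha', rfl⟩ := hps.1 hp'
        exact ⟨(j_inj hM e).symm, hjm.symm⟩
      · intro a' ha'
        have := hY.subset_of_mem ha ha'
        exact ⟨_, hjm.2 this, hps.2 ⟨this, rfl⟩⟩
      · intro hb
        have := hjm.1 hb
        exact (hc.2.2 a (hc.1.mem this) this).symm
    · intro a _ hp
      obtain ⟨ha, h⟩ := hps.1 hp
      rw [← (j_inj hM e).1 h]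
      have h1 : θ ∈ θ₁ := mem_of_rank_lt hθo hθ₁ ((rank_lt_of_mem hθ).trans hrank)
      exact (j_ord hM e hc.1).mem_trans h1 hbig
    · intro a _ hp b _ hp'
      obtain ⟨ha, h⟩ := hps.1 hp
      obtain ⟨hb, h'⟩ := hps.1 hp'
      rw [← (j_inj hM e).1 h, ← (j_inj hM e).1 h']
      exact ⟨hr, hc.2.1⟩
  let I := ZFSet.sep (fun x => Guess x Y δ θ A r) (powerset (ZFSet.prod Y Y))
  have hI : ∀ x, x ∈ I ↔ Guess x Y δ θ A r := by
    intro x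
    rw [ZFSet.mem_sep, mem_powerset]
    refine ⟨fun h => h.2, fun h => ⟨fun p hp => ?_, h⟩⟩
    obtain ⟨a, ha, b, hb, rfl⟩ := h.1 p hp
    exact pair_mem_prod.2 ⟨ha, hb⟩
  let U := ZFSet.sep (fun X => s ∈ e.j X) (powerset I)
  have hU : ∀ X, X ∈ U ↔ X ⊆ I ∧ s ∈ e.j X := by
    intro X; rw [ZFSet.mem_sep, mem_powerset]
  have hsI : s ∈ e.j I := by
    have : FO.{u} (Γ := Fin 7) (fun M v => ∀ x, x ∈ M → (x ∈ v 0 ↔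
      Guess x (v 1) (v 2) (v 3) (v 4) (v 5))) := .all (.iff (.mem _ _) (.guess _ _ _ _ _ _))
    exact ((this.transfer hM e ![I, Y, δ, θ, A, r, ∅]).1 (fun x _ => hI x) s hsM).2 hguess
  refine ⟨I, U, fun x hx => (hI x).1 hx, fun X hX => ((hU X).1 hX).1, ?_, ?_, ?_, ?_, ?_⟩
  · intro X hX X' hX'
    rw [hU] at hX hX'
    refine ⟨X ∩ X', (hU _).2 ⟨fun x hx => hX.1 (mem_inter.1 hx).1, ?_⟩,
      fun x hx => (mem_inter.1 hx).1, fun x hx => (mem_inter.1 hx).2⟩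
    have : FO.{u} (Γ := Fin 3) (fun M v => ∀ x, x ∈ v 0 → x ∈ v 1 → x ∈ v 2) :=
      .ball _ (.imp (.mem _ _) (.mem _ _))
    exact (this.transfer hM e ![X, X', X ∩ X']).1 (fun x h h' => mem_inter.2 ⟨h, h'⟩) s hX.2 hX'.2
  · intro X hX
    rw [hU] at hX
    rcases X.eq_empty_or_nonempty with rfl | ⟨x, hx⟩
    · rw [j_empty hM e] at hX
      exact (notMem_empty _ hX.2).elim
    · exact ⟨x, hx, rfl⟩
  · intro X _ hX
    have : FO.{u} (Γ := Fin 3) (fun M v => ∀ x, x ∈ v 0 → x ∈ v 1 ∨ x ∈ v 2) :=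
      .ball _ (.or (.mem _ _) (.mem _ _))
    rcases (this.transfer hM e ![I, X, I \ X]).1 (fun x h => by
      by_cases h' : x ∈ X
      · exact Or.inl h'
      · exact Or.inr (mem_sdiff.2 ⟨h, h'⟩)) s hsI with h | h
    · exact ⟨X, (hU _).2 ⟨hX, h⟩, Or.inl fun x hx => hx⟩
    · exact ⟨I \ X, (hU _).2 ⟨fun x hx => (mem_sdiff.1 hx).1, h⟩,
        Or.inr fun x hx => (mem_sdiff.1 hx).2⟩
  · intro y hy
    let X := ZFSet.sep (fun x => ∃ a, a ∈ Y ∧ pair a y ∈ x) I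
    refine ⟨X, (hU _).2 ⟨fun x hx => (ZFSet.mem_sep.1 hx).1, ?_⟩,
      fun x hx => (ZFSet.mem_sep.1 hx).2⟩
    have : FO.{u} (Γ := Fin 4) (fun M v => ∀ x, x ∈ v 0 →
        (∃ a, a ∈ v 1 ∧ pair a (v 2) ∈ x) → x ∈ v 3) :=
      .ball _ (.imp (.bex _ (.pair_mem _ _ _)) (.mem _ _))
    exact (this.transfer hM e ![I, Y, y, X]).1
      (fun x h h' => (show x ∈ X from ZFSet.mem_sep.2 ⟨h, h'⟩)) s hsI ⟨y, hj y hy, hps.2 ⟨hy, rfl⟩⟩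
  · intro X hX g _ hg
    rw [hU] at hX
    have : FO.{u} (Γ := Fin 3) (fun M v => ∀ x, x ∈ v 0 →
        ∃ a, a ∈ v 1 ∧ ∃ b, b ∈ v 1 ∧ (pair a b ∈ x ∧ pair x b ∈ v 2)) :=
      .ball _ (.bex _ (.bex _ (.and (.pair_mem _ _ _) (.pair_mem _ _ _))))
    obtain ⟨a, _, b, _, h1, h2⟩ := (this.transfer hM e ![X, Y, g]).1 hg s hX.2
    obtain ⟨ha, rfl⟩ := hps.1 h1
    let X' := ZFSet.sep (fun x => pair x a ∈ g) X
    refine ⟨a, ha, X', (hU _).2 ⟨fun x hx => hX.1 (ZFSet.mem_sep.1 hx).1, ?_⟩,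
      fun x hx => (ZFSet.mem_sep.1 hx).2⟩
    have : FO.{u} (Γ := Fin 4) (fun M v => ∀ x, x ∈ v 0 → pair x (v 1) ∈ v 2 → x ∈ v 3) :=
      .ball _ (.imp (.pair_mem _ _ _) (.mem _ _))
    exact (this.transfer hM e ![X, a, g, X']).1 (fun x h h' => (show x ∈ X' from ZFSet.mem_sep.2 ⟨h, h'⟩)) s hX.2 h2

end LaverDiamond

namespace LaverDiamond

open ZFSet Ordinal Filter

instance small_toSet (x : ZFSet.{u}) : Small.{u} x.toSet := inferInstanceAs (Small.{u} x)

/-- The ultrafilter generated by (the elements of) `U` on the elements of `I`. -/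
theorem exists_ultrafilter {I U : ZFSet.{u}} (hU : ∃ X, X ∈ U)
    (hI : ∀ X, X ∈ U → X ⊆ I)
    (hdir : ∀ X, X ∈ U → ∀ X', X' ∈ U → ∃ X'', X'' ∈ U ∧ (X'' ⊆ X ∧ X'' ⊆ X'))
    (hne : ∀ X, X ∈ U → ∃ x, x ∈ X)
    (hult : ∀ X, X ⊆ I → ∃ X', X' ∈ U ∧ (X' ⊆ X ∨ ∀ x, x ∈ X' → ¬ x ∈ X)) :
    ∃ D : Ultrafilter I.toSet, ∀ p : I.toSet → Prop,
      (∀ᶠ s in (D : Filter I.toSet), p s) ↔ ∃ X, X ∈ U ∧ ∀ s : I.toSet, s.1 ∈ X → p s := by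
  let F : Filter I.toSet :=
    { sets := {S | ∃ X, X ∈ U ∧ ∀ s : I.toSet, s.1 ∈ X → s ∈ S}
      univ_sets := by
        obtain ⟨X, hX⟩ := hU
        exact ⟨X, hX, fun _ _ => trivial⟩
      sets_of_superset := by
        rintro S S' ⟨X, hX, h⟩ h'
        exact ⟨X, hX, fun s hs => h' (h s hs)⟩
      inter_sets := by
        rintro S S' ⟨X, hX, h⟩ ⟨X', hX', h'⟩
        obtain ⟨X'', hX'', h1, h2⟩ := hdir X hX X' hX'
        exact ⟨X'', hX'', fun s hs => ⟨h s (h1 hs), h' s (h2 hs)⟩⟩ }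
  have hF : ∀ S : Set I.toSet, S ∈ F ↔ ∃ X, X ∈ U ∧ ∀ s : I.toSet, s.1 ∈ X → s ∈ S :=
    fun S => Iff.rfl
  refine ⟨Ultrafilter.ofComplNotMemIff F fun S => ?_, fun p => Iff.rfl⟩
  rw [hF, hF]
  constructor
  · intro h
    let X := ZFSet.sep (fun x => ∃ hx : x ∈ I, (⟨x, hx⟩ : I.toSet) ∈ S) I
    obtain ⟨X', hX', h1 | h1⟩ := hult X fun x hx => (ZFSet.mem_sep.1 hx).1
    · refine ⟨X', hX', fun s hs => ?_⟩
      obtain ⟨_, hx, h2⟩ := ZFSet.mem_sep.1 (h1 hs)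
      exact h2
    · exact (h ⟨X', hX', fun s hs hS => h1 _ hs (ZFSet.mem_sep.2 ⟨s.2, s.2, hS⟩)⟩).elim
  · rintro ⟨X, hX, h⟩ ⟨X', hX', h'⟩
    obtain ⟨X'', hX'', h1, h2⟩ := hdir X hX X' hX'
    obtain ⟨x, hx⟩ := hne X'' hX''
    exact h' ⟨x, hI _ hX'' hx⟩ (h2 hx) (h _ (h1 hx))

/-- The ultrapower by a fine normal measure concentrating on guesses. -/
theorem exists_sc_of_meas {κ θ Y A r I U : ZFSet.{u}} (h : Meas V I U Y κ θ A r)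
    (hY : Y.IsTransitive) (hκ : κ ∈ Y) (hθ : θ ∈ Y) (hA : A ∈ Y) (hκo : κ.IsOrdinal)
    (hom : om ∈ κ) : ∃ E : SCEmb κ θ, pair κ A ∈ E.e.j r := by
  obtain ⟨hG, hUI, hdir, hne, hult, hfine, hnorm⟩ := h
  have hYt : ∀ {a b}, b ∈ Y → a ∈ b → a ∈ Y := fun hb ha => hY.subset_of_mem hb ha
  obtain ⟨D, hD⟩ := exists_ultrafilter (I := I) (U := U)
    (by obtain ⟨X, hX, _⟩ := hfine κ hκ; exact ⟨X, hX⟩) hUI hdir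
    (fun X hX => by obtain ⟨x, hx, _⟩ := hne X hX; exact ⟨x, hx⟩)
    (fun X hX => hult X trivial hX)
  have fine : ∀ y ∈ Y, ∀ᶠ s in (D : Filter I.toSet), ∃ a, a ∈ Y ∧ pair a y ∈ s.1 := by
    intro y hy
    obtain ⟨X, hX, h⟩ := hfine y hy
    exact (hD _).2 ⟨X, hX, fun s hs => h _ hs⟩
  have hpY : ∀ (s : I.toSet) {a b}, pair a b ∈ s.1 → a ∈ Y ∧ b ∈ Y := by
    intro s a b hab
    obtain ⟨a', ha', b', hb', e⟩ := (hG s.1 s.2).1 _ hab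
    obtain ⟨rfl, rfl⟩ := pair_inj.1 e
    exact ⟨ha', hb'⟩
  have norm : ∀ h : I.toSet → ZFSet.{u}, (∀ᶠ s in (D : Filter I.toSet), ∃ a, pair a (h s) ∈ s.1) →
      ∃ y ∈ Y, ∀ᶠ s in (D : Filter I.toSet), h s = y := by
    intro h hh
    obtain ⟨X, hX, hX'⟩ := (hD _).1 hh
    classical
    let g := gr I (fun x => if hx : x ∈ I then h ⟨x, hx⟩ else ∅)
    have hg : ∀ (s : I.toSet) b, pair s.1 b ∈ g ↔ b = h s := by
      intro s b
      rw [pair_mem_gr, dif_pos (show s.1 ∈ I from s.2)]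
      exact ⟨fun h => h.2, fun h => ⟨s.2, h⟩⟩
    obtain ⟨y, hy, X', hX', h'⟩ := hnorm X hX g trivial (fun x hx => by
      obtain ⟨a, ha⟩ := hX' ⟨x, hUI _ hX hx⟩ hx
      exact ⟨a, (hpY _ ha).1, _, (hpY _ ha).2, ha, (hg ⟨x, hUI _ hX hx⟩ _).2 rfl⟩)
    exact ⟨y, hy, (hD _).2 ⟨X', hX', fun s hs => ((hg s y).1 (h' _ hs)).symm⟩⟩
  let W : UltraFamily I.toSet D :=
    { Fn := Set.univ
      comp := fun _ _ _ _ => trivial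
      wf := by
        intro h _ hdec
        have hex : ∀ s : I.toSet, ∃ n, ¬ h (n + 1) s ∈ h n s := fun s =>
          WellFounded.not_rel_apply_succ (r := fun a b : ZFSet.{u} => a ∈ b) (fun n => h n s)
        choose n hn using hex
        obtain ⟨y, hy, hys⟩ := norm (fun s => ((n s : ℕ) : Ordinal.{u}).toZFSet) (by
          filter_upwards [fine om (hYt hκ hom)] with s ⟨a, haY, ha⟩
          have hom' := hYt hκ hom
          obtain ⟨h1, h2, h3⟩ := (hG s.1 s.2).2.1 a haY om hom' ha
          obtain rfl := h3 hom
          have hns : ((n s : ℕ) : Ordinal.{u}).toZFSet ∈ om := mem_om.2 ⟨_, rfl⟩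
          obtain ⟨b, hb, hp⟩ := h2 _ hns
          obtain ⟨h4, h5⟩ := h1 _ (hYt hom' hns) b hb hp
          have h6 := ((hG s.1 s.2).2.1 _ (hYt hom' hns) b hb hp).1 _ hom' _ hom' ha
          have h7 : b ∈ κ := hκo.mem_trans (h6.2.1 hns) hom
          have h8 := ((hG s.1 s.2).2.1 _ (hYt hom' hns) b hb hp).2.2 h7
          exact ⟨b, by rw [h8]; rwa [h8] at hp⟩)
        obtain ⟨s₀, hs₀⟩ := hys.exists
        obtain ⟨s, h1, h2⟩ := (hys.and (hdec (n s₀))).exists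
        have : n s = n s₀ := by
          have := toZFSet_injective (h1.trans hs₀.symm)
          exact_mod_cast this
        rw [← this] at h2
        exact hn s h2 }
  have hM := W.trans_Ult
  let e := W.emb
  let T : W.Fn := ⟨fun s => s.1, trivial⟩
  have hT : Guess (W.mos T) (e.j Y) (e.j κ) (e.j θ) (e.j A) (e.j r) := by
    have := W.fo_los (FO.guess (Γ := Fin 6) 0 1 2 3 4 5)
      ![T, W.cst Y, W.cst κ, W.cst θ, W.cst A, W.cst r]
    exact this.2 (Eventually.of_forall fun s => hG s.1 s.2)
  have hpair : ∀ g h k : W.Fn, pair (W.mos g) (W.mos h) ∈ W.mos k ↔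
      ∀ᶠ s in (D : Filter I.toSet), pair (g.1 s) (h.1 s) ∈ k.1 s := fun g h k =>
    W.fo_los (FO.pair_mem (Γ := Fin 3) 0 1 2) ![g, h, k]
  have hTfine : ∀ y ∈ Y, ∃ u, u ∈ e.j Y ∧ pair u (e.j y) ∈ W.mos T := by
    intro y hy
    have : FO.{u} (Γ := Fin 3) (fun _ v => ∃ a, a ∈ v 0 ∧ pair a (v 1) ∈ v 2) :=
      .bex _ (.pair_mem _ _ _)
    exact (W.fo_los this ![W.cst Y, W.cst y, T]).2 (fine y hy)
  have hTY : ∀ {u w}, pair u w ∈ W.mos T → u ∈ e.j Y ∧ w ∈ e.j Y := by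
    intro a b hab
    obtain ⟨a', ha', b', hb', e⟩ := hT.1 _ hab
    obtain ⟨rfl, rfl⟩ := pair_inj.1 e
    exact ⟨ha', hb'⟩
  have hTnorm : ∀ u w, pair u w ∈ W.mos T → ∃ y ∈ Y, w = e.j y := by
    intro u w hp
    obtain ⟨⟨g, rfl⟩, ⟨h, rfl⟩⟩ := hM.of_pair_mem hp ⟨_, rfl⟩
    obtain ⟨y, hy, hys⟩ := norm h.1 (((hpair _ _ _).1 hp).mono fun s hs => ⟨_, hs⟩)
    exact ⟨y, hy, W.mos_eq.2 hys⟩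
  have hcoll : ∀ y, y ∈ Y → ∀ u, pair u (e.j y) ∈ W.mos T → u = y := by
    intro y
    induction y using ZFSet.inductionOn with
    | _ y ih =>
    intro hy u hu
    have hu2 := hT.2.1 u (hTY hu).1 _ (hTY hu).2 hu
    ext z
    constructor
    · intro hz
      obtain ⟨b, hb, hp⟩ := hu2.2.1 z hz
      obtain ⟨y', hy', rfl⟩ := hTnorm _ _ hp
      have h1 := (hT.2.1 z (hTY hp).1 _ (hTY hp).2 hp).1 u (hTY hu).1 _ (hTY hu).2 hu
      have h2 := (j_mem_iff hM e).1 (h1.2.1 hz)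
      rwa [ih y' h2 hy' z hp]
    · intro hz
      obtain ⟨u', _, hp⟩ := hTfine z (hYt hy hz)
      obtain rfl := ih z hz (hYt hy hz) u' hp
      have h1 := (hT.2.1 u' (hTY hp).1 _ (hTY hp).2 hp).1 u (hTY hu).1 _ (hTY hu).2 hu
      exact h1.2.2 ((j_mem_iff hM e).2 hz)
  have hyT : ∀ y ∈ Y, pair y (e.j y) ∈ W.mos T := by
    intro y hy
    obtain ⟨u, _, hp⟩ := hTfine y hy
    obtain rfl := hcoll y hy u hp
    exact hp
  have hfin := hT.2.2.2 κ (hTY (hyT κ hκ)).1 (hyT κ hκ) A (hTY (hyT A hA)).1 (hyT A hA)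
  refine ⟨⟨W.Ult, hM, e, ⟨hκo, hfin.2, ?_⟩, ?_, hT.2.2.1 θ (hTY (hyT θ hθ)).1 (hyT θ hθ)⟩, hfin.1⟩
  · intro α _ hα
    have hp := hyT α (hYt hκ hα)
    exact ((hT.2.1 α (hTY hp).1 _ (hTY hp).2 hp).2.2 ((j_mem_iff hM e).2 hα)).symm
  · intro f hf
    have hex : ∀ a, ∃ g : W.Fn, a ∈ θ → pair a (W.mos g) ∈ f := by
      intro a
      by_cases ha : a ∈ θ
      · obtain ⟨b, hb, _⟩ := hf.2 a ha
        obtain ⟨a', b', _, hb', e⟩ := hf.1 _ hb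
        obtain ⟨rfl, rfl⟩ := pair_inj.1 e
        obtain ⟨g, rfl⟩ := hb'
        exact ⟨g, fun _ => hb⟩
      · exact ⟨T, fun h => (ha h).elim⟩
    choose H hH using hex
    have hGex : ∀ s : I.toSet, ∃ G : ZFSet.{u}, ∀ q, q ∈ G ↔
        ∃ u w, pair u w ∈ s.1 ∧ w ∈ θ ∧ q = pair u ((H w).1 s) := by
      intro s
      let P := fun p => ∃ u w, p = pair u w ∧ w ∈ θ
      let F := fun p => Classical.epsilon (fun q => ∃ u w, p = pair u w ∧ q = pair u ((H w).1 s))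
      have hF : ∀ u w, F (pair u w) = pair u ((H w).1 s) := by
        intro u w
        obtain ⟨u', w', e1, e2⟩ := Classical.epsilon_spec
          (p := fun q => ∃ u' w', pair u w = pair u' w' ∧ q = pair u' ((H w').1 s))
          ⟨_, u, w, rfl, rfl⟩
        obtain ⟨rfl, rfl⟩ := pair_inj.1 e1
        exact e2
      refine ⟨ZFSet.range (fun p : (ZFSet.sep P s.1).toSet => F p), fun q => ?_⟩
      rw [ZFSet.mem_range]
      constructor
      · rintro ⟨⟨p, hp⟩, rfl⟩
        obtain ⟨hp, u, w, rfl, hw⟩ := ZFSet.mem_sep.1 hp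
        exact ⟨u, w, hp, hw, hF u w⟩
      · rintro ⟨u, w, hp, hw, rfl⟩
        exact ⟨⟨pair u w, ZFSet.mem_sep.2 ⟨hp, u, w, rfl, hw⟩⟩, hF u w⟩
    choose G hG' using hGex
    refine ⟨⟨G, trivial⟩, ?_⟩
    have hmp : ∀ g h k : W.Fn, W.mos g = pair (W.mos h) (W.mos k) ↔
        ∀ᶠ s in (D : Filter I.toSet), g.1 s = pair (h.1 s) (k.1 s) := fun g h k =>
      W.fo_los (FO.eq_pair (Γ := Fin 3) 0 1 2) ![g, h, k]
    ext q
    constructor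
    · intro hq
      obtain ⟨g, rfl, hg⟩ := W.mem_mos.1 hq
      have hg' : ∀ s : I.toSet, ∃ u w, g.1 s ∈ G s →
          pair u w ∈ s.1 ∧ w ∈ θ ∧ g.1 s = pair u ((H w).1 s) := by
        intro s
        by_cases hs : g.1 s ∈ G s
        · obtain ⟨u, w, h⟩ := (hG' s _).1 hs
          exact ⟨u, w, fun _ => h⟩
        · exact ⟨∅, ∅, fun h => (hs h).elim⟩
      choose gu gw hguw using hg'
      obtain ⟨y, hy, hys⟩ := norm gw (hg.mono fun s hs => ⟨_, (hguw s hs).1⟩)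
      have hyθ : y ∈ θ := by
        obtain ⟨s, h1, h2⟩ := (hys.and hg).exists
        rw [← h1]
        exact (hguw s h2).2.1
      have h1 : pair (W.mos ⟨gu, trivial⟩) (e.j y) ∈ W.mos T := by
        refine (hpair ⟨gu, trivial⟩ (W.cst y) T).2 ?_
        filter_upwards [hys, hg] with s h1 h2
        have := (hguw s h2).1
        rw [h1] at this
        exact this
      have h2 := hcoll y hy _ h1
      have h3 : W.mos g = pair (W.mos ⟨gu, trivial⟩) (W.mos (H y)) := by
        refine (hmp _ _ _).2 ?_
        filter_upwards [hys, hg] with s h1 h2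
        rw [(hguw s h2).2.2, h1]
      rw [h3, h2]
      exact hH y hyθ
    · intro hq
      obtain ⟨a, b, ha, hb, rfl⟩ := hf.1 q hq
      obtain rfl := (hf.2 a ha).unique hq (hH a ha)
      have hp := hyT a (hYt hθ ha)
      obtain ⟨⟨ga, rfl⟩, _⟩ := hM.of_pair_mem hp ⟨_, rfl⟩
      refine (hpair _ _ ⟨G, trivial⟩).2 ?_
      filter_upwards [(hpair ga (W.cst _) T).1 hp] with s hs
      exact (hG' s _).2 ⟨_, _, hs, ha, rfl⟩

end LaverDiamond

namespace LaverDiamond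

open ZFSet Ordinal Filter

/-- The function coded by `e` maps `X` to a set containing `c`. -/
def Inn (M : Set ZFSet.{u}) (e X c : ZFSet.{u}) : Prop :=
  ∃ u, u ∈ M ∧ (pair X u ∈ e ∧ c ∈ u)

theorem FO.inn {Γ : Type} (e X c : Γ) : FO.{u} (fun M v => Inn M (v e) (v X) (v c)) :=
  .ex (.and (.pair_mem _ _ _) (.mem _ _))

/-- The function coded by `e` maps `p` to a set containing the pair of `c` and `a`. -/
def InP (M : Set ZFSet.{u}) (e p c a : ZFSet.{u}) : Prop :=
  ∃ d, d ∈ M ∧ (d = pair c a ∧ Inn M e p d)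

theorem FO.inP {Γ : Type} (e p c a : Γ) : FO.{u} (fun M v => InP M (v e) (v p) (v c) (v a)) :=
  .ex (.and (.eq_pair _ _ _) (.inn _ _ _))

/-- The set `σ` relates every natural number to at most one set. -/
def SeqFun (M : Set ZFSet.{u}) (w σ : ZFSet.{u}) : Prop :=
  ∀ n, n ∈ w → ∀ c, c ∈ M → ∀ c', c' ∈ M → pair n c ∈ σ → pair n c' ∈ σ → c = c'

theorem FO.seqFun {Γ : Type} (w σ : Γ) : FO.{u} (fun M v => SeqFun M (v w) (v σ)) :=
  .ball _ (.all (.all (.imp (.pair_mem _ _ _) (.imp (.pair_mem _ _ _) (.eq _ _)))))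

/-- The sequence `z` of elements of `D` is a descending chain for the sequence of relations `τ`. -/
def Chain (M : Set ZFSet.{u}) (w D τ z : ZFSet.{u}) : Prop :=
  SeqFun M w z ∧ ∀ n, n ∈ w → ∃ m, m ∈ w ∧ (m = insert n n ∧ ∃ x, x ∈ D ∧ ∃ y, y ∈ D ∧
    (pair n y ∈ z ∧ (pair m x ∈ z ∧ ∀ t, t ∈ M → pair n t ∈ τ → pair x y ∈ t)))

theorem FO.chain {Γ : Type} (w D τ z : Γ) :
    FO.{u} (fun M v => Chain M (v w) (v D) (v τ) (v z)) :=
  .and (.seqFun _ _) (.ball _ (.bex _ (.and (.eq_insert _ _) (.bex _ (.bex _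
    (.and (.pair_mem _ _ _) (.and (.pair_mem _ _ _)
      (.all (.imp (.pair_mem _ _ _) (.pair_mem _ _ _))))))))))

/-- In the sense of `M`, `e` codes an extender on `D` with support `S` and critical point `δ`;
Boolean part. -/
def ExtBool (M : Set ZFSet.{u}) (e D S : ZFSet.{u}) : Prop :=
  (∀ X, X ∈ M → X ⊆ D → ∀ X', X' ∈ M → X' ⊆ D → (∀ z, z ∈ D → z ∈ X ∨ z ∈ X') →
    ∀ c, c ∈ S → Inn M e X c ∨ Inn M e X' c) ∧
  (∀ X, X ∈ M → ∀ X', X' ∈ M → ∀ X'', X'' ∈ M → X'' ⊆ D →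
    (∀ z, z ∈ X → z ∈ X' → z ∈ X'') →
    ∀ c, c ∈ S → Inn M e X c → Inn M e X' c → Inn M e X'' c) ∧
  (∀ X, X ∈ M → ∀ c, c ∈ S → Inn M e X c → ∃ x, x ∈ X ∧ x = x)

theorem FO.extBool {Γ : Type} (e D S : Γ) :
    FO.{u} (fun M v => ExtBool M (v e) (v D) (v S)) :=
  .and (.all (.imp (.subset _ _) (.all (.imp (.subset _ _) (.imp
    (.ball _ (.or (.mem _ _) (.mem _ _))) (.ball _ (.or (.inn _ _ _) (.inn _ _ _))))))))
  (.and (.all (.all (.all (.imp (.subset _ _) (.imp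
    (.ball _ (.imp (.mem _ _) (.mem _ _)))
    (.ball _ (.imp (.inn _ _ _) (.imp (.inn _ _ _) (.inn _ _ _)))))))))
  (.all (.ball _ (.imp (.inn _ _ _) (.bex _ (.eq _ _))))))

/-- In the sense of `M`, `e` codes an extender: compatibility with functions. -/
def ExtFun (M : Set ZFSet.{u}) (e D S : ZFSet.{u}) : Prop :=
  (∀ x, x ∈ D → ∀ y, y ∈ D → pair x y ∈ D) ∧
  (∀ p, p ∈ M → ∀ X, X ∈ M → ∀ X', X' ∈ M → X' ⊆ D →
    (∀ y, y ∈ X → ∀ x, x ∈ D → pair x y ∈ p → x ∈ X') →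
    ∀ c, c ∈ S → ∀ a, a ∈ S → InP M e p c a → Inn M e X a → Inn M e X' c) ∧
  (∀ p, p ∈ M → ∀ q, q ∈ M → ∀ t, t ∈ M → ∀ X, X ∈ M → X ⊆ D →
    (∀ x, x ∈ D → ∀ y, y ∈ D → ∀ z, z ∈ D → ∀ w, w ∈ D → w = pair y z →
      pair x w ∈ p → pair x y ∈ q → pair x z ∈ t → x ∈ X) →
    ∀ c, c ∈ S → ∀ a, a ∈ S → ∀ b, b ∈ S → ∀ d, d ∈ S → d = pair a b →
      InP M e p c d → InP M e q c a → InP M e t c b → Inn M e X c) ∧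
  (∀ p, p ∈ M → ∀ q, q ∈ M → ∀ t, t ∈ M → t ⊆ D →
    (∀ x, x ∈ D → ∀ y, y ∈ D → ∀ z, z ∈ D → pair x y ∈ p → pair y z ∈ q → pair x z ∈ t) →
    ∀ c, c ∈ S → ∀ a, a ∈ S → ∀ b, b ∈ S →
      InP M e p c a → InP M e q a b → InP M e t c b) ∧
  (∀ p, p ∈ M → p ⊆ D →
    (∀ x, x ∈ D → ∀ y, y ∈ D → ∀ w, w ∈ D → w = pair x y → pair w x ∈ p) →
    ∀ a, a ∈ S → ∀ b, b ∈ S → ∀ d, d ∈ S → d = pair a b → InP M e p d a) ∧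
  (∀ p, p ∈ M → p ⊆ D →
    (∀ x, x ∈ D → ∀ y, y ∈ D → ∀ w, w ∈ D → w = pair x y → pair w y ∈ p) →
    ∀ a, a ∈ S → ∀ b, b ∈ S → ∀ d, d ∈ S → d = pair a b → InP M e p d b)

theorem FO.extFun {Γ : Type} (e D S : Γ) :
    FO.{u} (fun M v => ExtFun M (v e) (v D) (v S)) :=
  .and (.ball _ (.ball _ (.pair_mem _ _ _)))
  (.and (.all (.all (.all (.imp (.subset _ _) (.imp
    (.ball _ (.ball _ (.imp (.pair_mem _ _ _) (.mem _ _))))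
    (.ball _ (.ball _ (.imp (.inP _ _ _ _) (.imp (.inn _ _ _) (.inn _ _ _))))))))))
  (.and (.all (.all (.all (.all (.imp (.subset _ _) (.imp
    (.ball _ (.ball _ (.ball _ (.ball _ (.imp (.eq_pair _ _ _) (.imp (.pair_mem _ _ _)
      (.imp (.pair_mem _ _ _) (.imp (.pair_mem _ _ _) (.mem _ _)))))))))
    (.ball _ (.ball _ (.ball _ (.ball _ (.imp (.eq_pair _ _ _) (.imp (.inP _ _ _ _)
      (.imp (.inP _ _ _ _) (.imp (.inP _ _ _ _) (.inn _ _ _)))))))))))))))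
  (.and (.all (.all (.all (.imp (.subset _ _) (.imp
    (.ball _ (.ball _ (.ball _ (.imp (.pair_mem _ _ _) (.imp (.pair_mem _ _ _)
      (.pair_mem _ _ _))))))
    (.ball _ (.ball _ (.ball _ (.imp (.inP _ _ _ _) (.imp (.inP _ _ _ _)
      (.inP _ _ _ _)))))))))))
  (.and (.all (.imp (.subset _ _) (.imp
    (.ball _ (.ball _ (.ball _ (.imp (.eq_pair _ _ _) (.pair_mem _ _ _)))))
    (.ball _ (.ball _ (.ball _ (.imp (.eq_pair _ _ _) (.inP _ _ _ _))))))))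
  (.all (.imp (.subset _ _) (.imp
    (.ball _ (.ball _ (.ball _ (.imp (.eq_pair _ _ _) (.pair_mem _ _ _)))))
    (.ball _ (.ball _ (.ball _ (.imp (.eq_pair _ _ _) (.inP _ _ _ _))))))))))))

/-- In the sense of `M`, `e` codes an extender: normality, wellfoundedness and critical point. -/
def ExtNorm (M : Set ZFSet.{u}) (e δ D S w : ZFSet.{u}) : Prop :=
  (∀ p, p ∈ M → p ⊆ D → (∀ y, y ∈ D → ∀ x, x ∈ y → pair x y ∈ p) →
    ∀ c, c ∈ S → ∀ a, a ∈ c → InP M e p a c) ∧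
  (∀ q, q ∈ M → ∀ p, p ∈ M → p ⊆ D →
    (∀ x, x ∈ D → ∀ y, y ∈ D → pair x y ∈ q → ∃ z, z ∈ y ∧ pair x z ∈ p) →
    ∀ d, d ∈ S → ∀ c, c ∈ S → InP M e q d c → ∃ b, b ∈ c ∧ InP M e p d b) ∧
  (∀ σ, σ ∈ M → ∀ τ, τ ∈ M → SeqFun M w σ → SeqFun M w τ →
    (∀ n, n ∈ w → ∃ m, m ∈ w ∧ (m = insert n n ∧ ∃ c, c ∈ S ∧ ∃ c', c' ∈ S ∧ ∃ t, t ∈ M ∧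
      (pair n c ∈ σ ∧ (pair m c' ∈ σ ∧ (pair n t ∈ τ ∧ InP M e t c' c))))) →
    ∃ z, z ∈ M ∧ Chain M w D τ z) ∧
  (∀ X, X ∈ M → X ⊆ D → ∀ α, α ∈ δ → α ∈ X → Inn M e X α) ∧
  (∀ X, X ∈ M → X ⊆ D → δ ⊆ X → Inn M e X δ)

theorem FO.extNorm {Γ : Type} (e δ D S w : Γ) :
    FO.{u} (fun M v => ExtNorm M (v e) (v δ) (v D) (v S) (v w)) :=
  .and (.all (.imp (.subset _ _) (.imp (.ball _ (.ball _ (.pair_mem _ _ _)))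
    (.ball _ (.ball _ (.inP _ _ _ _))))))
  (.and (.all (.all (.imp (.subset _ _) (.imp
    (.ball _ (.ball _ (.imp (.pair_mem _ _ _) (.bex _ (.pair_mem _ _ _)))))
    (.ball _ (.ball _ (.imp (.inP _ _ _ _) (.bex _ (.inP _ _ _ _)))))))))
  (.and (.all (.all (.imp (.seqFun _ _) (.imp (.seqFun _ _) (.imp
    (.ball _ (.bex _ (.and (.eq_insert _ _) (.bex _ (.bex _ (.ex
      (.and (.pair_mem _ _ _) (.and (.pair_mem _ _ _)
        (.and (.pair_mem _ _ _) (.inP _ _ _ _))))))))))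
    (.ex (.chain _ _ _ _)))))))
  (.and (.all (.imp (.subset _ _) (.ball _ (.imp (.mem _ _) (.inn _ _ _)))))
  (.all (.imp (.subset _ _) (.imp (.subset _ _) (.inn _ _ _)))))))

/-- In the sense of `M`, every suitable `S ∈ W` is the support of an extender with critical point
`δ`. -/
def ExtBelow (M : Set ZFSet.{u}) (W δ w : ZFSet.{u}) : Prop :=
  ∀ S, S ∈ W → ∀ D, D ∈ S → S.IsTransitive → (∀ a, a ∈ S → ∀ b, b ∈ S → pair a b ∈ S) →
    δ ∈ S → (∀ y, y ∈ M → (y ∈ D ↔ RankLt M y δ)) →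
    ∃ e, e ∈ M ∧ (ExtBool M e D S ∧ (ExtFun M e D S ∧ ExtNorm M e δ D S w))

theorem FO.extBelow {Γ : Type} (W δ w : Γ) :
    FO.{u} (fun M v => ExtBelow M (v W) (v δ) (v w)) :=
  .ball _ (.ball _ (.imp (.trans _) (.imp (.ball _ (.ball _ (.pair_mem _ _ _))) (.imp (.mem _ _)
    (.imp (.all (.iff (.mem _ _) (.rankLt _ _)))
      (.ex (.and (.extBool _ _ _) (.and (.extFun _ _ _) (.extNorm _ _ _ _ _)))))))))

end LaverDiamond

namespace LaverDiamond

open ZFSet Ordinal Filter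

/-- `E X c` says that `c` belongs to the image of `X` under an extender on `D` with support `S`
and critical point `δ`. -/
structure Extender (E : ZFSet.{u} → ZFSet.{u} → Prop) (δ D S : ZFSet.{u}) : Prop where
  ordinal : δ.IsOrdinal
  mem_supp : δ ∈ S
  supp_trans : S.IsTransitive
  supp_pair : ∀ a ∈ S, ∀ b ∈ S, pair a b ∈ S
  base_trans : D.IsTransitive
  base_pair : ∀ a ∈ D, ∀ b ∈ D, pair a b ∈ D
  sub_base : δ ⊆ D
  ultra : ∀ X ⊆ D, ∀ X' ⊆ D, (∀ z ∈ D, z ∈ X ∨ z ∈ X') → ∀ c ∈ S, E X c ∨ E X' c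
  meet : ∀ X ⊆ D, ∀ X' ⊆ D, ∀ c ∈ S, E X c → E X' c → E (X ∩ X') c
  ne : ∀ X ⊆ D, ∀ c ∈ S, E X c → ∃ x, x ∈ X
  preim : ∀ f : ZFSet.{u} → ZFSet.{u}, (∀ x ∈ D, f x ∈ D) → ∀ X ⊆ D, ∀ c ∈ S, ∀ a ∈ S,
    E (gr D f) (pair c a) → E X a → E (ZFSet.sep (fun x => f x ∈ X) D) c
  pairing : ∀ f g h : ZFSet.{u} → ZFSet.{u}, (∀ x ∈ D, f x ∈ D) → (∀ x ∈ D, g x ∈ D) →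
    (∀ x ∈ D, h x ∈ D) → ∀ c ∈ S, ∀ a ∈ S, ∀ b ∈ S, E (gr D f) (pair c (pair a b)) →
    E (gr D g) (pair c a) → E (gr D h) (pair c b) →
    E (ZFSet.sep (fun x => f x = pair (g x) (h x)) D) c
  comp : ∀ f g : ZFSet.{u} → ZFSet.{u}, (∀ x ∈ D, f x ∈ D) → (∀ x ∈ D, g x ∈ D) →
    ∀ c ∈ S, ∀ a ∈ S, ∀ b ∈ S, E (gr D f) (pair c a) → E (gr D g) (pair a b) →
    E (gr D fun x => g (f x)) (pair c b)
  fst : ∀ f : ZFSet.{u} → ZFSet.{u}, (∀ x ∈ D, f x ∈ D) → (∀ x y, f (pair x y) = x) →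
    ∀ a ∈ S, ∀ b ∈ S, E (gr D f) (pair (pair a b) a)
  snd : ∀ f : ZFSet.{u} → ZFSet.{u}, (∀ x ∈ D, f x ∈ D) → (∀ x y, f (pair x y) = y) →
    ∀ a ∈ S, ∀ b ∈ S, E (gr D f) (pair (pair a b) b)
  mem : ∀ c ∈ S, ∀ a ∈ c,
    E (ZFSet.sep (fun p => ∃ x y, p = pair x y ∧ x ∈ y) D) (pair a c)
  regr : ∀ f : ZFSet.{u} → ZFSet.{u}, ∀ d ∈ S, ∀ c ∈ S,
    E (ZFSet.sep (fun p => ∃ x y, p = pair x y ∧ f x ∈ y) D) (pair d c) →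
    ∃ b ∈ c, E (ZFSet.sep (fun p => ∃ x y, p = pair x y ∧ y = f x) D) (pair d b)
  chain : ∀ c : ℕ → ZFSet.{u}, (∀ n, c n ∈ S) → ∀ t : ℕ → ZFSet.{u}, (∀ n, t n ⊆ D) →
    (∀ n, E (t n) (pair (c (n + 1)) (c n))) → ∃ z : ℕ → ZFSet.{u}, ∀ n, pair (z (n + 1)) (z n) ∈ t n
  low : ∀ X ⊆ D, ∀ α ∈ δ, α ∈ X → E X α
  crit : E δ δ

theorem exists_fst : ∃ F : ZFSet.{u} → ZFSet.{u}, ∀ x y, F (pair x y) = x := by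
  classical
  refine ⟨fun p => if h : ∃ x y, p = pair x y then h.choose else p, fun x y => ?_⟩
  have h : ∃ x' y', pair x y = pair x' y' := ⟨x, y, rfl⟩
  simp only [h, dif_pos]
  obtain ⟨y', e⟩ := h.choose_spec
  exact (pair_inj.1 e).1.symm

theorem exists_snd : ∃ F : ZFSet.{u} → ZFSet.{u}, ∀ x y, F (pair x y) = y := by
  classical
  refine ⟨fun p => if h : ∃ y x, p = pair x y then h.choose else p, fun x y => ?_⟩
  have h : ∃ y' x', pair x y = pair x' y' := ⟨y, x, rfl⟩
  simp only [h, dif_pos]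
  obtain ⟨y', e⟩ := h.choose_spec
  exact (pair_inj.1 e).2.symm

theorem pair_mem_of_trans {D : ZFSet.{u}} (hD : D.IsTransitive) {a b : ZFSet.{u}}
    (h : pair a b ∈ D) : a ∈ D ∧ b ∈ D :=
  TransClass.pair_left (M := {z | z ∈ D}) (fun _ ha _ hb => hD _ ha hb) h

/-- A function extracting the first component of pairs, preserving a given transitive set. -/
theorem exists_fst_on {D : ZFSet.{u}} (hD : D.IsTransitive) :
    ∃ F : ZFSet.{u} → ZFSet.{u}, (∀ x y, F (pair x y) = x) ∧ ∀ x ∈ D, F x ∈ D := by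
  classical
  obtain ⟨F, hF⟩ := exists_fst.{u}
  refine ⟨fun p => if ∃ x y, p = pair x y then F p else p, fun x y => ?_, fun p hp => ?_⟩
  · exact (if_pos ⟨x, y, rfl⟩).trans (hF x y)
  · dsimp only
    split_ifs with h
    · obtain ⟨x, y, rfl⟩ := h
      rw [hF]
      exact (pair_mem_of_trans hD hp).1
    · exact hp

/-- A function extracting the second component of pairs, preserving a given transitive set. -/
theorem exists_snd_on {D : ZFSet.{u}} (hD : D.IsTransitive) :
    ∃ F : ZFSet.{u} → ZFSet.{u}, (∀ x y, F (pair x y) = y) ∧ ∀ x ∈ D, F x ∈ D := by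
  classical
  obtain ⟨F, hF⟩ := exists_snd.{u}
  refine ⟨fun p => if ∃ x y, p = pair x y then F p else p, fun x y => ?_, fun p hp => ?_⟩
  · exact (if_pos ⟨x, y, rfl⟩).trans (hF x y)
  · dsimp only
    split_ifs with h
    · obtain ⟨x, y, rfl⟩ := h
      rw [hF]
      exact (pair_mem_of_trans hD hp).2
    · exact hp

namespace Extender

variable {E : ZFSet.{u} → ZFSet.{u} → Prop} {δ D S : ZFSet.{u}} (H : Extender E δ D S)
include H

theorem univ (c : ZFSet.{u}) (hc : c ∈ S) : E D c :=
  (H.ultra D (fun _ h => h) D (fun _ h => h) (fun _ h => Or.inl h) c hc).elim id id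

theorem exists_code (Γ : Finset ZFSet.{u}) (hΓ : ∀ a ∈ Γ, a ∈ S) :
    ∃ c ∈ S, ∃ p : ZFSet.{u} → ZFSet.{u} → ZFSet.{u},
      ∀ a ∈ Γ, (∀ x ∈ D, p a x ∈ D) ∧ E (gr D (p a)) (pair c a) := by
  classical
  induction Γ using Finset.induction_on with
  | empty => exact ⟨δ, H.mem_supp, fun _ x => x, by simp⟩
  | insert a Γ _ ih =>
    obtain ⟨c, hc, p, hp⟩ := ih fun b hb => hΓ b (Finset.mem_insert_of_mem hb)
    have ha : a ∈ S := hΓ a (Finset.mem_insert_self _ _)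
    obtain ⟨F, hF, hFD⟩ := exists_fst_on H.base_trans
    obtain ⟨G, hG, hGD⟩ := exists_snd_on H.base_trans
    refine ⟨pair a c, H.supp_pair a ha c hc, fun b => if b = a then F else fun x => p b (G x),
      fun b hb => ?_⟩
    by_cases hba : b = a
    · subst hba
      simp only [if_true]
      exact ⟨hFD, H.fst F hFD hF b ha c hc⟩
    · simp only [if_neg hba]
      have hb' := hp b ((Finset.mem_insert.1 hb).resolve_left hba)
      exact ⟨fun x hx => hb'.1 _ (hGD x hx), H.comp G (p b) hGD hb'.1 _ (H.supp_pair a ha c hc) c hc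
        b (hΓ b hb) (H.snd G hGD hG a ha c hc) hb'.2⟩

/-- The basic sets generating the filter on `S → D` associated to an extender. -/
def basic (E : ZFSet.{u} → ZFSet.{u} → Prop) (D S : ZFSet.{u}) : Set (Set (S.toSet → D.toSet)) :=
  {A | (∃ X, X ⊆ D ∧ ∃ c : S.toSet, E X c.1 ∧ A = {s | (s c).1 ∈ X}) ∨
    ∃ a b d : S.toSet, d.1 = pair a.1 b.1 ∧ A = {s | (s d).1 = pair (s a).1 (s b).1}}

theorem basic_fip (t : Set (Set (S.toSet → D.toSet))) (ht : t ⊆ basic E D S) (hfin : t.Finite) :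
    ∃ Δ : Finset ZFSet.{u}, (∀ a ∈ Δ, a ∈ S) ∧ ∀ (Γ : Finset ZFSet.{u}), Δ ⊆ Γ →
      ∀ c ∈ S, ∀ p : ZFSet.{u} → ZFSet.{u} → ZFSet.{u},
      (∀ a ∈ Γ, (∀ x ∈ D, p a x ∈ D) ∧ E (gr D (p a)) (pair c a)) →
      ∃ X, X ⊆ D ∧ E X c ∧ ∀ x ∈ X, ∀ s : S.toSet → D.toSet,
        (∀ a : S.toSet, a.1 ∈ Γ → (s a).1 = p a.1 x) → s ∈ ⋂₀ t := by
  classical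
  induction t, hfin using Set.Finite.induction_on with
  | empty => exact ⟨∅, by simp, fun Γ _ c hc p _ => ⟨D, fun _ h => h, H.univ c hc, by simp⟩⟩
  | @insert A t _ _ ih =>
    obtain ⟨Δ, h0, h1⟩ := ih fun B hB => ht (Set.mem_insert_of_mem _ hB)
    rcases ht (Set.mem_insert A t) with ⟨X, hX, a, hE, rfl⟩ | ⟨a, b, d, hd, rfl⟩
    · refine ⟨insert a.1 Δ, by simpa using h0, fun Γ hΓ c hc p hp => ?_⟩
      obtain ⟨X', hX', hE', h2⟩ := h1 Γ ((Finset.subset_insert _ _).trans hΓ) c hc p hp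
      have ha : a.1 ∈ Γ := hΓ (Finset.mem_insert_self _ _)
      have h3 := H.preim (p a.1) (hp _ ha).1 X hX c hc a.1 a.2 (hp _ ha).2 hE
      refine ⟨_ ∩ X', fun z hz => hX' (ZFSet.mem_inter.1 hz).2,
        H.meet _ (fun z hz => (ZFSet.mem_sep.1 hz).1) X' hX' c hc h3 hE', fun x hx s hs => ?_⟩
      obtain ⟨hx1, hx2⟩ := ZFSet.mem_inter.1 hx
      rw [Set.sInter_insert]
      refine ⟨?_, h2 x hx2 s hs⟩
      rw [Set.mem_ofPred_eq, hs a ha]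
      exact (ZFSet.mem_sep.1 hx1).2
    · refine ⟨insert a.1 (insert b.1 (insert d.1 Δ)), by simpa using h0,
        fun Γ hΓ c hc p hp => ?_⟩
      obtain ⟨X', hX', hE', h2⟩ := h1 Γ (fun z hz => hΓ (by simp [hz])) c hc p hp
      have ha : a.1 ∈ Γ := hΓ (by simp)
      have hb : b.1 ∈ Γ := hΓ (by simp)
      have hd' : d.1 ∈ Γ := hΓ (by simp)
      have h3 := H.pairing (p d.1) (p a.1) (p b.1) (hp _ hd').1 (hp _ ha).1 (hp _ hb).1 c hc
        a.1 a.2 b.1 b.2 (hd ▸ (hp _ hd').2) (hp _ ha).2 (hp _ hb).2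
      refine ⟨_ ∩ X', fun z hz => hX' (ZFSet.mem_inter.1 hz).2,
        H.meet _ (fun z hz => (ZFSet.mem_sep.1 hz).1) X' hX' c hc h3 hE', fun x hx s hs => ?_⟩
      obtain ⟨hx1, hx2⟩ := ZFSet.mem_inter.1 hx
      rw [Set.sInter_insert]
      refine ⟨?_, h2 x hx2 s hs⟩
      rw [Set.mem_ofPred_eq, hs a ha, hs b hb, hs d hd']
      exact (ZFSet.mem_sep.1 hx1).2

theorem exists_ultrafilter : ∃ U : Ultrafilter (S.toSet → D.toSet),
    (∀ X ⊆ D, ∀ c : S.toSet, (∀ᶠ s in (U : Filter (S.toSet → D.toSet)), (s c).1 ∈ X) ↔ E X c.1) ∧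
    ∀ a b d : S.toSet, d.1 = pair a.1 b.1 →
      ∀ᶠ s in (U : Filter (S.toSet → D.toSet)), (s d).1 = pair (s a).1 (s b).1 := by
  classical
  have hne : (Filter.generate (basic E D S)).NeBot := by
    rw [Filter.generate_neBot_iff]
    intro t ht hfin
    obtain ⟨Γ, h0, h1⟩ := H.basic_fip t ht hfin
    obtain ⟨c, hc, p, hp⟩ := H.exists_code Γ h0
    obtain ⟨X, hX, hE, h2⟩ := h1 Γ (fun _ h => h) c hc p hp
    obtain ⟨x, hx⟩ := H.ne X hX c hc hE
    refine ⟨fun a => if h : a.1 ∈ Γ then ⟨p a.1 x, (hp _ h).1 x (hX hx)⟩ else ⟨x, hX hx⟩,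
      h2 x hx _ fun a ha => ?_⟩
    simp [ha]
  let U := Ultrafilter.of (Filter.generate (basic E D S))
  have hU : ∀ A ∈ basic E D S, A ∈ U := fun A hA =>
    Ultrafilter.of_le _ (Filter.mem_generate_of_mem hA)
  refine ⟨U, fun X hX c => ⟨fun h => ?_, fun h => hU _ (Or.inl ⟨X, hX, c, h, rfl⟩)⟩,
    fun a b d hd => hU _ (Or.inr ⟨a, b, d, hd, rfl⟩)⟩
  have hX' : D \ X ⊆ D := fun z hz => (ZFSet.mem_sdiff.1 hz).1
  rcases H.ultra X hX (D \ X) hX' (fun z hz => by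
    by_cases h : z ∈ X
    · exact Or.inl h
    · exact Or.inr (ZFSet.mem_sdiff.2 ⟨hz, h⟩)) c.1 c.2 with h1 | h1
  · exact h1
  · have h2 : ∀ᶠ s in (U : Filter (S.toSet → D.toSet)), (s c).1 ∈ D \ X :=
      hU _ (Or.inl ⟨_, hX', c, h1, rfl⟩)
    obtain ⟨s, h3, h4⟩ := (h.and h2).exists
    exact ((ZFSet.mem_sdiff.1 h4).2 h3).elim

end Extender

end LaverDiamond

namespace LaverDiamond

open ZFSet Ordinal Filter

namespace Extender

variable {E : ZFSet.{u} → ZFSet.{u} → Prop} {δ D S : ZFSet.{u}} (H : Extender E δ D S)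
include H

section
variable {U : Ultrafilter (S.toSet → D.toSet)}
  (hP : ∀ a b d : S.toSet, d.1 = pair a.1 b.1 →
    ∀ᶠ s in (U : Filter (S.toSet → D.toSet)), (s d).1 = pair (s a).1 (s b).1)
include hP

theorem exists_common (n : ℕ) (c : Fin n → S.toSet) :
    ∃ (d : S.toSet) (g : Fin n → ZFSet.{u} → ZFSet.{u}), ∀ k,
      ∀ᶠ s in (U : Filter (S.toSet → D.toSet)), (s (c k)).1 = g k (s d).1 := by
  obtain ⟨F, hF⟩ := exists_fst.{u}
  obtain ⟨G, hG⟩ := exists_snd.{u}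
  induction n with
  | zero => exact ⟨⟨δ, H.mem_supp⟩, fun k => k.elim0, fun k => k.elim0⟩
  | succ n ih =>
    obtain ⟨d, g, hg⟩ := ih fun k => c k.succ
    let d' : S.toSet := ⟨pair (c 0).1 d.1, H.supp_pair _ (c 0).2 _ d.2⟩
    have hd' := hP (c 0) d d' rfl
    refine ⟨d', Fin.cases F fun k x => g k (G x), fun k => ?_⟩
    refine Fin.cases ?_ (fun k => ?_) k
    · filter_upwards [hd'] with s hs
      simp [hs, hF]
    · filter_upwards [hd', hg k] with s hs hs'
      simp [hs, hs', hG]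

end

theorem strongAt {θ : ZFSet.{u}} (hθ : ∀ x, MemV θ x → x ∈ S) : StrongAt δ θ := by
  obtain ⟨U, hL, hP⟩ := H.exists_ultrafilter
  have hpair : ∀ t ⊆ D, ∀ a b : S.toSet, E t (pair a.1 b.1) ↔
      ∀ᶠ s in (U : Filter (S.toSet → D.toSet)), pair (s a).1 (s b).1 ∈ t := by
    intro t ht a b
    rw [← hL t ht ⟨pair a.1 b.1, H.supp_pair _ a.2 _ b.2⟩]
    refine eventually_congr ?_
    filter_upwards [hP a b ⟨pair a.1 b.1, H.supp_pair _ a.2 _ b.2⟩ rfl] with s hs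
    rw [hs]
  let W : UltraFamily (S.toSet → D.toSet) U :=
    { Fn := {h | ∃ (c : S.toSet) (f : ZFSet.{u} → ZFSet.{u}),
        ∀ᶠ s in (U : Filter (S.toSet → D.toSet)), h s = f (s c).1}
      comp := by
        intro n h hh F
        choose c f hf using hh
        obtain ⟨d, g, hg⟩ := H.exists_common hP n c
        refine ⟨d, fun x => F fun k => f k (g k x), ?_⟩
        have h1 : ∀ᶠ s in (U : Filter (S.toSet → D.toSet)), ∀ k, h k s = f k (g k (s d).1) := by
          rw [Filter.eventually_all]
          intro k
          filter_upwards [hf k, hg k] with s h1 h2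
          rw [h1, h2]
        filter_upwards [h1] with s hs
        simp only [hs]
      wf := by
        intro h hh hdesc
        choose c f hf using hh
        let t : ℕ → ZFSet.{u} := fun n =>
          ZFSet.sep (fun p => ∃ x y, p = pair x y ∧ f (n + 1) x ∈ f n y) D
        have ht : ∀ n, t n ⊆ D := fun n => ZFSet.sep_subset
        obtain ⟨z, hz⟩ := H.chain (fun n => (c n).1) (fun n => (c n).2) t ht fun n => by
          rw [hpair _ (ht n)]
          have hD := (hpair D (fun _ h => h) (c (n + 1)) (c n)).1
            (H.univ _ (H.supp_pair _ (c (n + 1)).2 _ (c n).2))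
          filter_upwards [hD, hf n, hf (n + 1), hdesc n] with s h0 h1 h2 h3
          rw [h1, h2] at h3
          exact ZFSet.mem_sep.2 ⟨h0, _, _, rfl, h3⟩
        refine WellFounded.not_rel_apply_succ (r := fun a b : ZFSet.{u} => a ∈ b)
          (fun n => f n (z n)) |>.elim fun n hn => hn ?_
        obtain ⟨_, x, y, e, h1⟩ := ZFSet.mem_sep.1 (hz n)
        obtain ⟨rfl, rfl⟩ := pair_inj.1 e
        exact h1 }
  let ev : S.toSet → W.Fn := fun c => ⟨fun s => (s c).1, c, id, Eventually.of_forall fun _ => rfl⟩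
  have hev : ∀ x, ∀ hx : x ∈ S, W.mos (ev ⟨x, hx⟩) = x := by
    intro x
    induction x using ZFSet.inductionOn with
    | _ x ih =>
      intro hx
      ext a
      rw [W.mem_mos]
      constructor
      · rintro ⟨⟨g, d, f, hf⟩, rfl, hg⟩
        obtain ⟨b, hb, hb'⟩ := H.regr f d.1 d.2 x hx <| by
          rw [hpair _ ZFSet.sep_subset d ⟨x, hx⟩]
          have hD := (hpair D (fun _ h => h) d ⟨x, hx⟩).1
            (H.univ _ (H.supp_pair _ d.2 _ hx))
          filter_upwards [hD, hf, hg] with s h0 h1 h2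
          refine ZFSet.mem_sep.2 ⟨h0, _, _, rfl, ?_⟩
          rw [← h1]
          exact h2
        have hbS : b ∈ S := H.supp_trans x hx hb
        rw [hpair _ ZFSet.sep_subset d ⟨b, hbS⟩] at hb'
        have : W.mos ⟨g, d, f, hf⟩ = W.mos (ev ⟨b, hbS⟩) := by
          rw [W.mos_eq]
          filter_upwards [hf, hb'] with s h1 h2
          obtain ⟨_, x, y, e, h3⟩ := ZFSet.mem_sep.1 h2
          obtain ⟨rfl, rfl⟩ := pair_inj.1 e
          exact h1.trans h3.symm
        rw [this, ih b hb hbS]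
        exact hb
      · intro ha
        have haS : a ∈ S := H.supp_trans x hx ha
        refine ⟨ev ⟨a, haS⟩, ih a ha haS, ?_⟩
        have h1 := H.mem x hx a ha
        rw [hpair _ ZFSet.sep_subset ⟨a, haS⟩ ⟨x, hx⟩] at h1
        filter_upwards [h1] with s h2
        obtain ⟨_, x, y, e, h3⟩ := ZFSet.mem_sep.1 h2
        obtain ⟨h4, h5⟩ := pair_inj.1 e
        change (s _).1 ∈ (s _).1
        rw [h4, h5]
        exact h3
  refine ⟨W.Ult, W.trans_Ult, W.emb, ⟨H.ordinal, ?_, fun α _ hα => ?_⟩, fun x hx => ?_⟩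
  · have : W.mos (ev ⟨δ, H.mem_supp⟩) ∈ W.mos (W.cst δ) :=
      W.mos_mem.2 ((hL δ H.sub_base ⟨δ, H.mem_supp⟩).2 H.crit)
    rwa [hev] at this
  · have hαS : α ∈ S := H.supp_trans δ H.mem_supp hα
    have hαD : α ∈ D := H.sub_base hα
    rw [W.emb_j]
    refine Eq.trans ?_ (hev α hαS)
    rw [W.mos_eq]
    have hs : ({α} : ZFSet) ⊆ D := fun z hz => ZFSet.mem_singleton.1 hz ▸ hαD
    filter_upwards [(hL _ hs ⟨α, hαS⟩).2 (H.low _ hs α hα (by simp))] with s h1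
    exact (ZFSet.mem_singleton.1 h1).symm
  · exact ⟨_, hev x (hθ x hx)⟩

end Extender

end LaverDiamond

namespace LaverDiamond

open ZFSet Ordinal Filter

theorem rank_gr_lt {γ β : Ordinal.{u}} (hγ : Order.IsSuccLimit γ) {x : ZFSet.{u}}
    {F : ZFSet.{u} → ZFSet.{u}} (hx : rank x < γ) (hβ : β < γ) (hF : ∀ a ∈ x, rank (F a) ≤ β) :
    rank (gr x F) < γ := by
  refine lt_of_le_of_lt (rank_le_iff.2 fun p hp => ?_)
    (hγ.succ_lt (hγ.succ_lt (hγ.succ_lt (max_lt hx hβ))))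
  obtain ⟨a, ha, rfl⟩ := mem_gr.1 hp
  rw [rank_opair, Order.lt_succ_iff]
  exact Order.succ_le_succ (Order.succ_le_succ (max_le_max (rank_lt_of_mem ha).le (hF a ha)))

theorem exists_index : ∃ N : ZFSet.{u} → ℕ, ∀ n : ℕ, N (n : Ordinal.{u}).toZFSet = n := by
  classical
  refine ⟨fun x => if h : ∃ n : ℕ, x = (n : Ordinal.{u}).toZFSet then h.choose else 0,
    fun n => ?_⟩
  have h : ∃ m : ℕ, (n : Ordinal.{u}).toZFSet = (m : Ordinal.{u}).toZFSet := ⟨n, rfl⟩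
  simp only [h, dif_pos]
  have := h.choose_spec
  rw [toZFSet_injective.eq_iff, Nat.cast_inj] at this
  exact this.symm

theorem nat_succ_toZFSet (n : ℕ) :
    ((n + 1 : ℕ) : Ordinal.{u}).toZFSet
      = insert (n : Ordinal.{u}).toZFSet (n : Ordinal.{u}).toZFSet := by
  rw [Nat.cast_succ, toZFSet_add_one]

theorem extender_of_ext {M : Set ZFSet.{u}} {e δ D S : ZFSet.{u}} {γ : Ordinal.{u}}
    (hγ : Order.IsSuccLimit γ) (hMγ : ∀ x, rank x < γ → x ∈ M) (hω : rank om < γ)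
    (hSγ : rank S < γ) (hDγ : rank D < γ) (hδ : δ.IsOrdinal) (hδS : δ ∈ S)
    (hS : S.IsTransitive) (hSp : ∀ a ∈ S, ∀ b ∈ S, pair a b ∈ S) (hD : D.IsTransitive)
    (hδD : δ ⊆ D) (hB : ExtBool M e D S) (hF : ExtFun M e D S) (hN : ExtNorm M e δ D S om) :
    Extender (Inn M e) δ D S := by
  obtain ⟨b1, b2, b3⟩ := hB
  obtain ⟨f1, f2, f3, f4, f5, f6⟩ := hF
  obtain ⟨n1, n2, n3, n4, n5⟩ := hN
  have sub : ∀ X, X ⊆ D → X ∈ M := fun X hX => hMγ X ((rank_mono hX).trans_lt hDγ)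
  have mS : ∀ c ∈ S, c ∈ M := fun c hc => hMγ c ((rank_lt_of_mem hc).trans hSγ)
  have mD : ∀ c ∈ D, c ∈ M := fun c hc => hMγ c ((rank_lt_of_mem hc).trans hDγ)
  have toP : ∀ {p c a}, c ∈ S → a ∈ S → (InP M e p c a ↔ Inn M e p (pair c a)) := by
    intro p c a hc ha
    constructor
    · rintro ⟨d, _, rfl, h⟩; exact h
    · intro h; exact ⟨_, mS _ (hSp c hc a ha), rfl, h⟩
  have grD : ∀ f : ZFSet.{u} → ZFSet.{u}, (∀ x ∈ D, f x ∈ D) → gr D f ⊆ D := by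
    intro f hf p hp
    obtain ⟨a, ha, rfl⟩ := mem_gr.1 hp
    exact f1 a ha _ (hf a ha)
  refine ⟨hδ, hδS, hS, hSp, hD, f1, hδD, ?_, ?_, ?_, ?_, ?_, ?_, ?_, ?_, ?_, ?_, ?_, ?_, ?_⟩
  · intro X hX X' hX' h c hc
    exact b1 X (sub X hX) hX X' (sub X' hX') hX' h c hc
  · intro X hX X' hX' c hc h h'
    have hs : X ∩ X' ⊆ D := fun z hz => hX (ZFSet.mem_inter.1 hz).1
    exact b2 X (sub X hX) X' (sub X' hX') _ (sub _ hs) hs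
      (fun z h h' => ZFSet.mem_inter.2 ⟨h, h'⟩) c hc h h'
  · intro X hX c hc h
    obtain ⟨x, hx, _⟩ := b3 X (sub X hX) c hc h
    exact ⟨x, hx⟩
  · intro f hf X hX c hc a ha h h'
    refine f2 _ (sub _ (grD f hf)) X (sub X hX) _ (sub _ ZFSet.sep_subset) ZFSet.sep_subset
      (fun y hy x hx hxy => ?_) c hc a ha ((toP hc ha).2 h) h'
    rw [pair_mem_gr] at hxy
    exact ZFSet.mem_sep.2 ⟨hx, hxy.2 ▸ hy⟩
  · intro f g h hf hg hh c hc a ha b hb h1 h2 h3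
    refine f3 _ (sub _ (grD f hf)) _ (sub _ (grD g hg)) _ (sub _ (grD h hh)) _
      (sub _ ZFSet.sep_subset) ZFSet.sep_subset ?_ c hc a ha b hb _ (hSp a ha b hb) rfl
      ((toP hc (hSp a ha b hb)).2 h1) ((toP hc ha).2 h2) ((toP hc hb).2 h3)
    intro x hx y _ z _ w _ hw hp hq ht
    rw [pair_mem_gr] at hp hq ht
    refine ZFSet.mem_sep.2 ⟨hx, ?_⟩
    rw [← hp.2, ← hq.2, ← ht.2, hw]
  · intro f g hf hg c hc a ha b hb h1 h2
    refine (toP hc hb).1 (f4 _ (sub _ (grD f hf)) _ (sub _ (grD g hg)) _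
      (sub _ (grD _ fun x hx => hg _ (hf x hx))) (grD _ fun x hx => hg _ (hf x hx)) ?_ c hc a ha b hb
      ((toP hc ha).2 h1) ((toP ha hb).2 h2))
    intro x hx y _ z _ hp hq
    rw [pair_mem_gr] at hp hq ⊢
    exact ⟨hx, by rw [← hp.2, hq.2]⟩
  · intro f hf h a ha b hb
    refine (toP (hSp a ha b hb) ha).1 (f5 _ (sub _ (grD f hf)) (grD f hf) ?_ a ha b hb _
      (hSp a ha b hb) rfl)
    rintro x _ y _ w hw rfl
    rw [pair_mem_gr]
    exact ⟨hw, (h x y).symm⟩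
  · intro f hf h a ha b hb
    refine (toP (hSp a ha b hb) hb).1 (f6 _ (sub _ (grD f hf)) (grD f hf) ?_ a ha b hb _
      (hSp a ha b hb) rfl)
    rintro x _ y _ w hw rfl
    rw [pair_mem_gr]
    exact ⟨hw, (h x y).symm⟩
  · intro c hc a ha
    refine (toP (hS c hc ha) hc).1 (n1 _ (sub _ ZFSet.sep_subset) ZFSet.sep_subset ?_ c hc a ha)
    intro y hy x hx
    exact ZFSet.mem_sep.2 ⟨f1 x (hD y hy hx) y hy, x, y, rfl, hx⟩
  · intro f d hd c hc h
    obtain ⟨b, hb, h'⟩ := n2 _ (sub _ ZFSet.sep_subset) _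
      (sub (ZFSet.sep (fun p => ∃ x y, p = pair x y ∧ y = f x) D) ZFSet.sep_subset)
      ZFSet.sep_subset (by
      intro x hx y hy hxy
      obtain ⟨_, x', y', e, h1⟩ := ZFSet.mem_sep.1 hxy
      obtain ⟨rfl, rfl⟩ := pair_inj.1 e
      exact ⟨f x, h1, ZFSet.mem_sep.2 ⟨f1 x hx _ (hD y hy h1), _, _, rfl, rfl⟩⟩) d hd c hc ((toP hd hc).2 h)
    exact ⟨b, hb, (toP hd (hS c hc hb)).1 h'⟩
  · intro c hc t ht hE
    obtain ⟨N, hNn⟩ := exists_index.{u}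
    have hσ : rank (gr om fun x => c (N x)) < γ :=
      rank_gr_lt hγ hω hSγ fun a _ => (rank_lt_of_mem (hc _)).le
    have hτ : rank (gr om fun x => t (N x)) < γ :=
      rank_gr_lt hγ hω hDγ fun a _ => rank_mono (ht _)
    have hfun : ∀ F : ZFSet.{u} → ZFSet.{u}, SeqFun M om (gr om F) := by
      intro F n _ x _ y _ h1 h2
      rw [pair_mem_gr] at h1 h2
      rw [h1.2, h2.2]
    have hom : ∀ n : ℕ, (n : Ordinal.{u}).toZFSet ∈ om := fun n => mem_om.2 ⟨n, rfl⟩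
    have hpg : ∀ (F : ℕ → ZFSet.{u}) (n : ℕ),
        pair (n : Ordinal.{u}).toZFSet (F n) ∈ gr om fun x => F (N x) := fun F n =>
      pair_mem_gr.2 ⟨hom n, by rw [hNn]⟩
    obtain ⟨z, _, hz, hch⟩ := n3 _ (hMγ _ hσ) _ (hMγ _ hτ) (hfun _) (hfun _) <| by
      intro n hn
      obtain ⟨n, rfl⟩ := mem_om.1 hn
      exact ⟨_, hom (n + 1), nat_succ_toZFSet n, _, hc n, _, hc (n + 1), _, sub _ (ht n),
        hpg c n, hpg c (n + 1), hpg t n, (toP (hc _) (hc _)).2 (hE n)⟩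
    have key : ∀ n : ℕ, ∃ x y, x ∈ D ∧ y ∈ D ∧ pair (n : Ordinal.{u}).toZFSet y ∈ z ∧
        pair ((n + 1 : ℕ) : Ordinal.{u}).toZFSet x ∈ z ∧ pair x y ∈ t n := by
      intro n
      obtain ⟨m, _, hm', x, hx, y, hy, h1, h2, h3⟩ := hch _ (hom n)
      rw [← nat_succ_toZFSet] at hm'
      exact ⟨x, y, hx, hy, h1, hm' ▸ h2, h3 _ (sub _ (ht n)) (hpg t n)⟩
    choose x y hx hy h1 h2 h3 using key
    refine ⟨y, fun n => ?_⟩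
    have : y (n + 1) = x n := hz _ (hom (n + 1)) _ (mD _ (hy _)) _ (mD _ (hx _)) (h1 _) (h2 _)
    rw [this]
    exact h3 n
  · intro X hX α hα h
    exact n4 X (sub X hX) hX α hα h
  · exact n5 δ (sub δ hδD) hδD fun _ h => h

end LaverDiamond

namespace LaverDiamond

open ZFSet Ordinal Filter

theorem exists_limit_gt (o : Ordinal.{u}) : ∃ γ, Order.IsSuccLimit γ ∧ o < γ :=
  ⟨o + ω, isSuccLimit_add o isSuccLimit_omega0, lt_add_of_pos_right o omega0_pos⟩

theorem SCEmb.mem_of_rank_lt {κ θ : ZFSet.{u}} (E : SCEmb κ θ) {γ : Ordinal.{u}}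
    (h : card (V_ γ) ≤ card θ) (x : ZFSet.{u}) (hx : rank x < γ) : x ∈ E.M :=
  trans_subset_class E.trans E.e E.closed (isTransitive_vonNeumann γ) h x (mem_vonNeumann.2 hx)

theorem strong_of_extBelow {κ δ : ZFSet.{u}} (hκ : Supercompact κ) (hδ : δ ∈ κ)
    (h : ExtBelow V (V_ (rank κ)) δ om) : Strong δ := by
  intro θ hθ
  obtain ⟨l, hl, hgl⟩ := exists_limit_gt (max (rank θ) (max (rank κ) ω))
  obtain ⟨γ, hγ, hlγ⟩ := exists_limit_gt l
  obtain ⟨μ, hμ, hcard, hrank⟩ := exists_isCard (V_ γ)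
  obtain ⟨E⟩ := hκ μ hμ
  have hθl : rank θ < l := (le_max_left _ _).trans_lt hgl
  have hκl : rank κ < l := ((le_max_left _ _).trans (le_max_right _ _)).trans_lt hgl
  have hωl : ω < l := ((le_max_right _ _).trans (le_max_right _ _)).trans_lt hgl
  have hκo := E.crit.1
  have hδo : δ.IsOrdinal := hκo.mem hδ
  have hM := E.mem_of_rank_lt hcard
  have hδκ := rank_lt_of_mem hδ
  have jδ : E.e.j δ = δ := j_fix E.trans E.e E.crit hδκ
  have jω : E.e.j om = om := j_fix E.trans E.e E.crit (by
    exact rank_lt_of_mem (om_mem_crit E.trans E.e E.crit))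
  have h' := ((FO.extBelow (Γ := Fin 3) 0 1 2).transfer E.trans E.e ![V_ (rank κ), δ, om]).1 h
  change ExtBelow E.M (E.e.j (V_ (rank κ))) (E.e.j δ) (E.e.j om) at h'
  rw [jδ, jω] at h'
  have hS : V_ l ∈ E.M := hM _ (by rwa [rank_vonNeumann])
  have hδl : rank δ < l := hδκ.trans hκl
  have hpair : ∀ a ∈ V_ l, ∀ b ∈ V_ l, pair a b ∈ V_ l := by
    intro a ha b hb
    rw [mem_vonNeumann] at *
    exact rank_opair_lt hl ha hb
  obtain ⟨e, -, hB, hF, hN⟩ := h' (V_ l) (by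
      rw [mem_j_V E.trans E.e hκo hS, rank_vonNeumann]
      rw [rank_vonNeumann] at hrank
      exact (hlγ.trans hrank).trans (rank_lt_of_mem E.big))
    (V_ (rank δ)) (by rwa [mem_vonNeumann, rank_vonNeumann]) (isTransitive_vonNeumann l) hpair
    (mem_vonNeumann.2 hδl) (fun y hy => by
      rw [rankLt_iff E.trans E.e hy (hM _ (hδl.trans hlγ)) hδo, mem_vonNeumann])
  refine (extender_of_ext hγ hM (by rw [rank_om]; exact hωl.trans hlγ)
    (by rwa [rank_vonNeumann]) (by rw [rank_vonNeumann]; exact hδl.trans hlγ) hδo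
    (mem_vonNeumann.2 hδl) (isTransitive_vonNeumann l) hpair (isTransitive_vonNeumann _)
    (fun x hx => mem_vonNeumann.2 (rank_lt_of_mem hx)) hB hF hN).strongAt fun x hx =>
      mem_vonNeumann.2 (hx.trans hθl)

end LaverDiamond

namespace LaverDiamond

open ZFSet Ordinal Filter

section derived

variable {M : Set ZFSet.{u}} (hM : TransClass M) (e : ClassEmb V M)

theorem inn_gr_iff {D X c : ZFSet.{u}} :
    Inn M (gr (powerset D) e.j) X c ↔ X ⊆ D ∧ c ∈ e.j X := by
  constructor
  · rintro ⟨u, _, h, hc⟩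
    rw [pair_mem_gr, mem_powerset] at h
    exact ⟨h.1, h.2 ▸ hc⟩
  · rintro ⟨h, hc⟩
    exact ⟨e.j X, e.maps _ trivial, pair_mem_gr.2 ⟨mem_powerset.2 h, rfl⟩, hc⟩

include hM

theorem inP_gr_iff {D p c a : ZFSet.{u}} :
    InP M (gr (powerset D) e.j) p c a ↔ p ⊆ D ∧ pair c a ∈ e.j p := by
  constructor
  · rintro ⟨d, _, rfl, h⟩; exact (inn_gr_iff e).1 h
  · intro h
    exact ⟨_, hM _ (e.maps p trivial) _ h.2, rfl, (inn_gr_iff e).2 h⟩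

theorem extBool_derived {D S : ZFSet.{u}} (hS : S ⊆ e.j D) :
    ExtBool M (gr (powerset D) e.j) D S := by
  simp only [ExtBool, inn_gr_iff e]
  refine ⟨fun X _ hX X' _ hX' h c hc => ?_, fun X _ X' _ X'' _ hX'' h c hc h1 h2 => ?_,
    fun X _ c hc h1 => ?_⟩
  · have : FO.{u} (Γ := Fin 3) (fun _ v => ∀ z, z ∈ v 0 → z ∈ v 1 ∨ z ∈ v 2) :=
      .ball _ (.or (.mem _ _) (.mem _ _))
    have := (this.transfer hM e ![D, X, X']).1 h c (hS hc)
    exact this.imp (fun h => ⟨hX, h⟩) (fun h => ⟨hX', h⟩)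
  · have : FO.{u} (Γ := Fin 3) (fun _ v => ∀ z, z ∈ v 0 → z ∈ v 1 → z ∈ v 2) :=
      .ball _ (.imp (.mem _ _) (.mem _ _))
    exact ⟨hX'', (this.transfer hM e ![X, X', X'']).1 h c h1.2 h2.2⟩
  · have : FO.{u} (Γ := Fin 1) (fun _ v => ∃ x, x ∈ v 0 ∧ x = x) := .bex _ (.eq _ _)
    obtain ⟨x, hx, -⟩ := (this.transfer hM e ![X]).2 ⟨c, h1.2, rfl⟩
    exact ⟨x, hx, trivial⟩

theorem extFun_derived {D S : ZFSet.{u}} (hS : S ⊆ e.j D)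
    (hD : ∀ x, x ∈ D → ∀ y, y ∈ D → pair x y ∈ D) :
    ExtFun M (gr (powerset D) e.j) D S := by
  simp only [ExtFun, inn_gr_iff e, inP_gr_iff hM e]
  refine ⟨hD, ?_, ?_, ?_, ?_, ?_⟩
  · intro p _ X _ X' _ hX' h c hc a ha h1 h2
    have : FO.{u} (Γ := Fin 4) (fun _ v =>
        ∀ y, y ∈ v 0 → ∀ x, x ∈ v 1 → pair x y ∈ v 2 → x ∈ v 3) :=
      .ball _ (.ball _ (.imp (.pair_mem _ _ _) (.mem _ _)))
    exact ⟨hX', (this.transfer hM e ![X, D, p, X']).1 h a h2.2 c (hS hc) h1.2⟩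
  · intro p _ q _ t _ X _ hX h c hc a ha b hb d hd hd' h1 h2 h3
    have : FO.{u} (Γ := Fin 5) (fun _ v =>
        ∀ x, x ∈ v 0 → ∀ y, y ∈ v 0 → ∀ z, z ∈ v 0 → ∀ w, w ∈ v 0 → w = pair y z →
          pair x w ∈ v 1 → pair x y ∈ v 2 → pair x z ∈ v 3 → x ∈ v 4) :=
      .ball _ (.ball _ (.ball _ (.ball _ (.imp (.eq_pair _ _ _) (.imp (.pair_mem _ _ _)
        (.imp (.pair_mem _ _ _) (.imp (.pair_mem _ _ _) (.mem _ _))))))))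
    exact ⟨hX, (this.transfer hM e ![D, p, q, t, X]).1 h c (hS hc) a (hS ha) b (hS hb) d (hS hd)
      hd' h1.2 h2.2 h3.2⟩
  · intro p _ q _ t _ ht h c hc a ha b hb h1 h2
    have : FO.{u} (Γ := Fin 4) (fun _ v =>
        ∀ x, x ∈ v 0 → ∀ y, y ∈ v 0 → ∀ z, z ∈ v 0 → pair x y ∈ v 1 → pair y z ∈ v 2 →
          pair x z ∈ v 3) :=
      .ball _ (.ball _ (.ball _ (.imp (.pair_mem _ _ _) (.imp (.pair_mem _ _ _)
        (.pair_mem _ _ _)))))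
    exact ⟨ht, (this.transfer hM e ![D, p, q, t]).1 h c (hS hc) a (hS ha) b (hS hb) h1.2 h2.2⟩
  · intro p _ hp h a ha b hb d hd hd'
    have : FO.{u} (Γ := Fin 2) (fun _ v =>
        ∀ x, x ∈ v 0 → ∀ y, y ∈ v 0 → ∀ w, w ∈ v 0 → w = pair x y → pair w x ∈ v 1) :=
      .ball _ (.ball _ (.ball _ (.imp (.eq_pair _ _ _) (.pair_mem _ _ _))))
    exact ⟨hp, (this.transfer hM e ![D, p]).1 h a (hS ha) b (hS hb) d (hS hd) hd'⟩
  · intro p _ hp h a ha b hb d hd hd'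
    have : FO.{u} (Γ := Fin 2) (fun _ v =>
        ∀ x, x ∈ v 0 → ∀ y, y ∈ v 0 → ∀ w, w ∈ v 0 → w = pair x y → pair w y ∈ v 1) :=
      .ball _ (.ball _ (.ball _ (.imp (.eq_pair _ _ _) (.pair_mem _ _ _))))
    exact ⟨hp, (this.transfer hM e ![D, p]).1 h a (hS ha) b (hS hb) d (hS hd) hd'⟩

theorem exists_chain_derived {κ D S σ τ : ZFSet.{u}} (hc : CritPt e.j κ) (hS : S ⊆ e.j D)
    (hσM : σ ∈ M) (hτM : τ ∈ M) (hσ : SeqFun M om σ) (hτ : SeqFun M om τ)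
    (h : ∀ n, n ∈ om → ∃ m, m ∈ om ∧ (m = insert n n ∧ ∃ c, c ∈ S ∧ ∃ c', c' ∈ S ∧ ∃ t, t ∈ M ∧
      (pair n c ∈ σ ∧ (pair m c' ∈ σ ∧ (pair n t ∈ τ ∧
        InP M (gr (powerset D) e.j) t c' c))))) :
    ∃ z, Chain V om D τ z := by
  have jω : e.j om = om := j_fix hM e hc (rank_lt_of_mem (om_mem_crit hM e hc))
  have jn : ∀ n ∈ om, e.j n = n := fun n hn => j_fix hM e hc
    ((rank_lt_of_mem hn).trans (rank_lt_of_mem (om_mem_crit hM e hc)))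
  have hτV : SeqFun V om τ := fun n hn c _ c' _ h1 h2 =>
    hτ n hn c (hM.of_pair_mem h1 hτM).2 c' (hM.of_pair_mem h2 hτM).2 h1 h2
  have hjτ := ((FO.seqFun (Γ := Fin 2) 0 1).transfer hM e ![om, τ]).1 hτV
  change SeqFun M (e.j om) (e.j τ) at hjτ
  rw [jω] at hjτ
  have : FO.{u} (Γ := Fin 3) (fun M v => ∃ z, z ∈ M ∧ Chain M (v 0) (v 1) (v 2) z) :=
    .ex (.chain _ _ _ _)
  have key := (this.transfer hM e ![om, D, τ]).2
  obtain ⟨z, -, hz⟩ := key (by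
    change ∃ z, z ∈ M ∧ Chain M (e.j om) (e.j D) (e.j τ) z
    rw [jω]
    refine ⟨σ, hσM, hσ, fun n hn => ?_⟩
    obtain ⟨m, hm, hmn, c, hc, c', hc', t, ht, h1, h2, h3, h4⟩ := h n hn
    refine ⟨m, hm, hmn, c', hS hc', c, hS hc, h1, h2, fun t' ht' h5 => ?_⟩
    have h6 : pair n (e.j t) ∈ e.j τ := by
      have := (j_mem_iff hM e).2 h3
      rwa [j_pair hM e, jn n hn] at this
    rw [hjτ n hn t' ht' _ (e.maps _ trivial) h5 h6]
    exact ((inP_gr_iff hM e).1 h4).2)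
  exact ⟨z, hz⟩

theorem extNorm_derived {κ S : ZFSet.{u}} {γ : Ordinal.{u}} (hc : CritPt e.j κ)
    (hκγ : rank κ < γ) (hMγ : ∀ x, rank x < γ → x ∈ M)
    (hS : S ⊆ e.j (V_ (rank κ))) :
    ExtNorm M (gr (powerset (V_ (rank κ))) e.j) κ (V_ (rank κ)) S om := by
  refine ⟨?_, ?_, ?_, ?_, ?_⟩
  · intro p _ hp h c hc a ha
    rw [inP_gr_iff hM e]
    have : FO.{u} (Γ := Fin 2) (fun _ v => ∀ y, y ∈ v 0 → ∀ x, x ∈ y → pair x y ∈ v 1) :=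
      .ball _ (.ball _ (.pair_mem _ _ _))
    exact ⟨hp, (this.transfer hM e ![V_ (rank κ), p]).1 h c (hS hc) a ha⟩
  · intro q _ p _ hp h d hd c hc h1
    simp only [inP_gr_iff hM e] at h1 ⊢
    have : FO.{u} (Γ := Fin 3) (fun _ v => ∀ x, x ∈ v 0 → ∀ y, y ∈ v 0 → pair x y ∈ v 1 →
        ∃ z, z ∈ y ∧ pair x z ∈ v 2) :=
      .ball _ (.ball _ (.imp (.pair_mem _ _ _) (.bex _ (.pair_mem _ _ _))))
    obtain ⟨b, hb, h2⟩ := (this.transfer hM e ![V_ (rank κ), q, p]).1 h d (hS hd) c (hS hc) h1.2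
    exact ⟨b, hb, hp, h2⟩
  · intro σ hσM τ hτM hσ hτ h
    obtain ⟨z, hz, hz'⟩ := exists_chain_derived hM e hc hS hσM hτM hσ hτ h
    have hrank : ∀ n ∈ om, ∀ x ∈ V_ (rank κ), rank (pair n x) < rank κ := fun n hn x hx =>
      rank_opair_lt (crit_limit hM e hc)
        ((rank_lt_of_mem hn).trans (rank_lt_of_mem (om_mem_crit hM e hc))) (mem_vonNeumann.1 hx)
    let z' := ZFSet.sep (fun p => rank p < rank κ) z
    have hz'M : z' ∈ M := hMγ _ (lt_of_le_of_lt (rank_le_iff.2 fun p hp =>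
      (ZFSet.mem_sep.1 hp).2) hκγ)
    refine ⟨z', hz'M, fun n hn c _ c' _ h1 h2 => hz n hn c trivial c' trivial
      (ZFSet.mem_sep.1 h1).1 (ZFSet.mem_sep.1 h2).1, fun n hn => ?_⟩
    obtain ⟨m, hm, hmn, x, hx, y, hy, h1, h2, h3⟩ := hz' n hn
    exact ⟨m, hm, hmn, x, hx, y, hy, ZFSet.mem_sep.2 ⟨h1, hrank n hn y hy⟩,
      ZFSet.mem_sep.2 ⟨h2, hrank m hm x hx⟩, fun t _ h4 => h3 t trivial h4⟩
  · intro X _ hX α hα h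
    rw [inn_gr_iff e]
    have := (j_mem_iff hM e).2 h
    rw [j_fix hM e hc (rank_lt_of_mem hα)] at this
    exact ⟨hX, this⟩
  · intro X _ hX h
    rw [inn_gr_iff e]
    exact ⟨hX, (j_subset_iff hM e).2 h hc.2.1⟩

end derived

theorem extBelow_of_scEmb {κ θ : ZFSet.{u}} {γ : Ordinal.{u}} (hκγ : rank κ < γ)
    (E : SCEmb κ θ) (hcard : card (V_ γ) ≤ card θ) :
    ExtBelow E.M (E.e.j (V_ (rank κ))) κ om := by
  have hMγ := E.mem_of_rank_lt hcard
  intro S hS D hDS hStr _ _ hD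
  have hjV : E.e.j (V_ (rank κ)) ∈ E.M := E.e.maps _ trivial
  have hSM : S ∈ E.M := E.trans _ hjV _ hS
  have hDM : D ∈ E.M := E.trans _ hSM _ hDS
  obtain rfl : D = V_ (rank κ) := by
    ext y
    have key : y ∈ E.M → (y ∈ D ↔ y ∈ V_ (rank κ)) := fun hy => by
      rw [hD y hy, rankLt_iff E.trans E.e hy (hMγ κ hκγ) E.crit.1, mem_vonNeumann]
    constructor
    · intro hy; exact (key (E.trans _ hDM _ hy)).1 hy
    · intro hy; exact (key (hMγ y ((mem_vonNeumann.1 hy).trans hκγ))).2 hy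
  have hSj : S ⊆ E.e.j (V_ (rank κ)) :=
    (j_trans E.trans E.e (isTransitive_vonNeumann _)).subset_of_mem hS
  have hlim := crit_limit E.trans E.e E.crit
  refine ⟨gr (powerset (V_ (rank κ))) E.e.j, ?_, extBool_derived E.trans E.e hSj,
    extFun_derived E.trans E.e hSj fun x hx y hy => ?_,
    extNorm_derived E.trans E.e E.crit hκγ hMγ hSj⟩
  · refine subset_mem_class E.trans E.e E.closed (fun p hp => ?_) ?_
    · obtain ⟨X, hX, rfl⟩ := mem_gr.1 hp
      refine pair_mem_class E.trans E.e (hMγ X ?_) (E.e.maps _ trivial)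
      have := rank_mono (mem_powerset.1 hX)
      rw [rank_vonNeumann] at this
      exact this.trans_lt hκγ
    · refine le_trans ?_ ((card_mono (x := powerset (V_ (rank κ))) (fun X hX => ?_)).trans hcard)
      · refine card_le_of_surj (fun X => pair X (E.e.j X)) fun p hp => ?_
        obtain ⟨X, hX, rfl⟩ := mem_gr.1 hp
        exact ⟨X, hX, rfl⟩
      · have := rank_mono (mem_powerset.1 hX)
        rw [rank_vonNeumann] at this
        exact mem_vonNeumann.2 (this.trans_lt hκγ)
  · rw [mem_vonNeumann] at *
    exact rank_opair_lt hlim hx hy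

end LaverDiamond

namespace LaverDiamond

open ZFSet Ordinal Filter

theorem mem_j_strong {κ θ : ZFSet.{u}} (hκ : Supercompact κ) {γ : Ordinal.{u}}
    (hκγ : rank κ < γ) (E : SCEmb κ θ) (hcard : card (V_ γ) ≤ card θ) :
    κ ∈ E.e.j (ZFSet.sep Strong κ) := by
  let B := ZFSet.sep (fun δ => ¬ Strong δ) κ
  have hB' : ∀ x, x ∈ B ↔ x ∈ κ ∧ ¬ Strong x := fun x => ZFSet.mem_sep
  have hS : ∀ x, x ∈ ZFSet.sep Strong κ ↔ x ∈ κ ∧ Strong x := fun x => ZFSet.mem_sep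
  have h1 : FO.{u} (Γ := Fin 3) (fun _ v => ∀ x, x ∈ v 0 → x ∈ v 1 ∨ x ∈ v 2) :=
    .ball _ (.or (.mem _ _) (.mem _ _))
  have h1 := (h1.transfer E.trans E.e ![κ, B, ZFSet.sep Strong κ]).1 (fun x hx => by
    by_cases h : Strong x
    · exact Or.inr ((hS x).2 ⟨hx, h⟩)
    · exact Or.inl ((hB' x).2 ⟨hx, h⟩)) κ E.crit.2.1
  refine h1.resolve_left fun hB => ?_
  have h2 : FO.{u} (Γ := Fin 3) (fun M v => ∀ x, x ∈ v 0 → ¬ ExtBelow M (v 1) x (v 2)) :=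
    .ball _ (.not (.extBelow _ _ _))
  have h2 := (h2.transfer E.trans E.e ![B, V_ (rank κ), om]).1 (fun x hx hE =>
    ((hB' x).1 hx).2 (strong_of_extBelow hκ ((hB' x).1 hx).1 hE)) κ hB
  change ¬ ExtBelow E.M (E.e.j (V_ (rank κ))) κ (E.e.j om) at h2
  rw [j_fix E.trans E.e E.crit (rank_lt_of_mem (om_mem_crit E.trans E.e E.crit))] at h2
  exact h2 (extBelow_of_scEmb hκγ E hcard)

/-- A supercompactness embedding yields such embeddings for smaller cardinals. -/
def SCEmb.restrict {κ θ θ₀ : ZFSet.{u}} (E : SCEmb κ θ) (hcard : card θ₀ ≤ card θ)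
    (hsub : ∀ a ∈ θ₀, a ∈ E.M) (h : θ₀ ∈ E.e.j κ) : SCEmb κ θ₀ :=
  ⟨E.M, E.trans, E.e, E.crit, seqClosed_mono E.trans E.e E.closed hcard hsub, h⟩

/-- Reflecting the existence of guessing measures for small supercompact cardinals. -/
theorem exists_meas_of_mem_j {κ θ' : ZFSet.{u}} (E : SCEmb κ θ') {D r : ZFSet.{u}}
    (hpf : IsPFun κ r)
    (hD : ∀ δ ∈ D, δ.IsOrdinal ∧ ∃ r', r' ⊆ r ∧ LDscFun δ r') (hκD : κ ∈ E.e.j D)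
    {γ γ' : Ordinal.{u}} (hγ' : Order.IsSuccLimit γ') (hγγ' : γ < γ')
    (hcard : card (V_ γ') ≤ card θ') {θ A : ZFSet.{u}} (hθ : θ.IsOrdinal) (hκγ : rank κ < γ)
    (hθγ : rank θ < γ) (hAγ : rank A < γ) :
    ∃ I U, Meas V I U (V_ γ) κ θ A r := by
  have hM := E.mem_of_rank_lt hcard
  have hYM : V_ γ ∈ E.M := hM _ (by rwa [rank_vonNeumann])
  have h1 : FO.{u} (Γ := Fin 2) (fun M v => ∀ δ, δ ∈ v 0 → ∀ Y, Y ∈ M → ∀ θ, θ ∈ Y → ∀ A, A ∈ Y →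
      Y.IsTransitive → θ.IsOrdinal → (∀ y, y ∈ M → RankLt M y δ → y ∈ Y) →
      ∃ I, I ∈ M ∧ ∃ U, U ∈ M ∧ Meas M I U Y δ θ A (v 1)) :=
    .ball _ (.all (.ball _ (.ball _ (.imp (.trans _) (.imp (.ord _) (.imp
      (.all (.imp (.rankLt _ _) (.mem _ _))) (.ex (.ex (.meas _ _ _ _ _ _ _)))))))))
  have h2 := (h1.transfer E.trans E.e ![D, r]).1 (by
    intro δ hδ Y _ θ hθ A hA hY hθo hV
    obtain ⟨hδo, r', hr', -, hL⟩ := hD δ hδ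
    obtain ⟨μ, hμ, hc, hr⟩ := exists_isCard Y
    obtain ⟨E', hE'⟩ := hL μ A hμ ⟨Y, hY, hA, mk_le_iff.2 hc⟩
    obtain ⟨I, U, h⟩ := exists_meas E' hY hθ hθo hμ.1 hc hr
      (fun y hy => hV y trivial ((rankLt_V hδo).2 hy))
      ((j_subset_iff E'.trans E'.e).2 hr' hE')
    exact ⟨I, trivial, U, trivial, h⟩) κ hκD (V_ γ) hYM θ (mem_vonNeumann.2 hθγ) A
      (mem_vonNeumann.2 hAγ) (isTransitive_vonNeumann γ) hθ (fun y hy h => by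
        rw [rankLt_iff E.trans E.e hy (hM _ (hκγ.trans hγγ')) E.crit.1] at h
        exact mem_vonNeumann.2 (h.trans hκγ))
  obtain ⟨I, -, U, -, h3⟩ := h2
  change Meas E.M I U (V_ γ) κ θ A (E.e.j r) at h3
  refine ⟨I, U, (h3.to_V hγ' (by rwa [rank_vonNeumann]) hM).mono fun a b ha hab => ?_⟩
  have ja := j_fix E.trans E.e E.crit (rank_lt_of_mem ha)
  have h4 : FO.{u} (Γ := Fin 3) (fun M v => (∀ b, b ∈ M → ¬ pair (v 0) b ∈ v 1)) :=
    .all (.not (.pair_mem _ _ _))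
  have h4 := (h4.transfer E.trans E.e ![a, r, ∅])
  have h5 : ∃ b', pair a b' ∈ r := by
    by_contra hcon
    push Not at hcon
    have := h4.1 (fun b _ => hcon b) b (E.trans.of_pair_mem hab (E.e.maps _ trivial)).2
    change ¬ pair (E.e.j a) b ∈ E.e.j r at this
    rw [ja] at this
    exact this hab
  obtain ⟨b', hb'⟩ := h5
  have hjb : E.e.j b' = b' := by
    obtain ⟨x, y, _, hy, e⟩ := hpf.1 _ hb'
    obtain ⟨rfl, rfl⟩ := pair_inj.1 e
    exact j_fix E.trans E.e E.crit hy
  have h6 : FO.{u} (Γ := Fin 1) (fun M v => ∀ a, a ∈ M → ∀ b, b ∈ M → ∀ b', b' ∈ M →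
      pair a b ∈ v 0 → pair a b' ∈ v 0 → b = b') :=
    .all (.all (.all (.imp (.pair_mem _ _ _) (.imp (.pair_mem _ _ _) (.eq _ _)))))
  have h7 : pair a b' ∈ E.e.j r := by
    have := (j_mem_iff E.trans E.e).2 hb'
    rwa [j_pair E.trans E.e, ja, hjb] at this
  have hrM := E.e.maps r trivial
  have := (h6.transfer E.trans E.e ![r]).1 (fun a _ b _ b' _ => hpf.2 a b b') a
    (E.trans.of_pair_mem hab hrM).1 b (E.trans.of_pair_mem hab hrM).2 b'
    (E.trans.of_pair_mem h7 hrM).2 hab h7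
  rwa [this]

theorem restrict_univLDsc (ℓ : ZFSet.{u} → ZFSet.{u}) (h : UnivLDsc ℓ) (κ : ZFSet.{u}) :
    Supercompact κ → ∃ r, RestrictEqOn ℓ {δ | Strong δ ∧ ¬ Supercompact δ} κ r ∧ LDscFun κ r := by
  induction κ using ZFSet.inductionOn with
  | _ κ ih =>
  intro hκ
  obtain ⟨r₀, hr₀, hpf₀, hL⟩ := h κ hκ
  let r := ZFSet.sep (fun p => ∃ γ, γ ∈ κ ∧ γ ∈ {δ | Strong δ ∧ ¬ Supercompact δ} ∧
    p = pair γ (ℓ γ)) r₀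
  have hr : RestrictEqOn ℓ {δ | Strong δ ∧ ¬ Supercompact δ} κ r := fun p =>
    ⟨fun hp => (ZFSet.mem_sep.1 hp).2, fun hp => ZFSet.mem_sep.2 ⟨(hr₀ p).2 (by
      obtain ⟨γ, hγ, _, e⟩ := hp
      exact ⟨γ, hγ, e⟩), hp⟩⟩
  have hpf : IsPFun κ r := ⟨fun p hp => hpf₀.1 p (ZFSet.mem_sep.1 hp).1,
    fun γ A B h1 h2 => hpf₀.2 γ A B (ZFSet.mem_sep.1 h1).1 (ZFSet.mem_sep.1 h2).1⟩
  refine ⟨r, hr, hpf, fun θ A hθ _ => ?_⟩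
  obtain ⟨γ, hγ, hgt⟩ := exists_limit_gt (max (rank κ) (max (rank θ) (rank A)))
  obtain ⟨γ', hγ', hγγ'⟩ := exists_limit_gt γ
  obtain ⟨μ, hμ, hcard, hrank⟩ := exists_isCard (V_ γ')
  rw [rank_vonNeumann] at hrank
  have hκγ : rank κ < γ := (le_max_left _ _).trans_lt hgt
  have hθγ : rank θ < γ := ((le_max_left _ _).trans (le_max_right _ _)).trans_lt hgt
  have hAγ : rank A < γ := ((le_max_right _ _).trans (le_max_right _ _)).trans_lt hgt
  obtain ⟨E, hE⟩ := hL μ A hμ ⟨V_ γ', isTransitive_vonNeumann _,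
    mem_vonNeumann.2 (hAγ.trans hγγ'), mk_le_iff.2 hcard⟩
  have hM := E.mem_of_rank_lt hcard
  have hstrong := mem_j_strong hκ (hκγ.trans hγγ') E hcard
  by_cases hC : κ ∈ E.e.j (ZFSet.sep Supercompact κ)
  · obtain ⟨I, U, hm⟩ := exists_meas_of_mem_j E hpf (fun δ hδ => by
      obtain ⟨hδκ, hδ⟩ := ZFSet.mem_sep.1 hδ
      obtain ⟨r', hr', hL'⟩ := ih δ hδκ hδ
      refine ⟨E.crit.1.mem hδκ, r', fun p hp => (hr p).2 ?_, hL'⟩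
      obtain ⟨x, hx, hx', e⟩ := (hr' p).1 hp
      exact ⟨x, E.crit.1.mem_trans hx hδκ, hx', e⟩) hC hγ' hγγ' hcard hθ.1 hκγ hθγ hAγ
    exact exists_sc_of_meas hm (isTransitive_vonNeumann γ) (mem_vonNeumann.2 hκγ)
      (mem_vonNeumann.2 hθγ) (mem_vonNeumann.2 hAγ) E.crit.1 (om_mem_crit E.trans E.e E.crit)
  · have hθM : ∀ a ∈ θ, a ∈ E.M := fun a ha =>
      hM a ((rank_lt_of_mem ha).trans (hθγ.trans hγγ'))
    refine ⟨E.restrict ?_ hθM ?_, ?_⟩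
    · refine (card_mono (y := V_ γ') fun x hx => ?_).trans hcard
      exact mem_vonNeumann.2 ((rank_lt_of_mem hx).trans (hθγ.trans hγγ'))
    · exact (j_ord E.trans E.e E.crit.1).mem_trans
        (mem_of_rank_lt hθ.1 hμ.1 ((hθγ.trans hγγ').trans hrank)) E.big
    · change pair κ A ∈ E.e.j r
      have h1 : FO.{u} (Γ := Fin 4) (fun M v => ∀ x, x ∈ v 0 → ∀ A, A ∈ M → pair x A ∈ v 1 →
          ¬ x ∈ v 2 → pair x A ∈ v 3) :=
        .ball _ (.all (.imp (.pair_mem _ _ _) (.imp (.not (.mem _ _)) (.pair_mem _ _ _))))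
      refine (h1.transfer E.trans E.e ![ZFSet.sep Strong κ, r₀, ZFSet.sep Supercompact κ, r]).1
        (fun x hx A _ hp hns => ?_) κ hstrong A (hM A (hAγ.trans hγγ')) hE hC
      obtain ⟨hxκ, hxs⟩ := ZFSet.mem_sep.1 hx
      refine (hr _).2 ⟨x, hxκ, ⟨hxs, fun hsc => hns (ZFSet.mem_sep.2 ⟨hxκ, hsc⟩)⟩, ?_⟩
      obtain ⟨y, _, e⟩ := (hr₀ _).1 hp
      obtain ⟨rfl, rfl⟩ := pair_inj.1 e
      rfl

end LaverDiamond

/-- The restriction of any universal `LD^sc` Laver function to the class of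
non-supercompact strong cardinals still witnesses `LD^sc`. -/
theorem restrict_univLDsc_to_nonSC_strong (ℓ : ZFSet.{u} → ZFSet.{u}) (h : UnivLDsc ℓ) :
    ∀ κ : ZFSet, Supercompact κ →
      ∃ r : ZFSet,
        RestrictEqOn ℓ {δ : ZFSet.{u} | Strong δ ∧ ¬ Supercompact δ} κ r ∧
        LDscFun κ r := by
  exact restrict_univLDsc ℓ h
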